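/- arXiv:1611.00264 — 6 statements merged into one kernel-verified Lean document; each statement's English description precedes it below -/
import Mathlib

section
/- Let n ≥ 1 and let Ω ⊂ ℝ^{n+1} be an open set whose boundary ∂Ω is n-AD-regular. Let B be a ball centered at a point of ∂Ω with radius r(B), and let u be a bounded function, harmonic in Ω and continuous on the closure of Ω, which vanishes on ∂Ω ∩ (5/2)B. Then ∫_{B∩Ω} |∇u(x)|² dist(x,∂Ω) dx ≤ C ‖u‖²_{L^∞(Ω)} r(B)ⁿ, where C depends only on n and the AD-regularity constant of ∂Ω. -/
open Metric MeasureTheory Set Filter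
open scoped ENNReal NNReal Topology

noncomputable section

/-- `E ⊂ ℝ^d` is `n`-AD-regular with constant `c₀`. -/
def ADRegularWith (c₀ : ℝ) (n : ℕ) {d : ℕ} (E : Set (EuclideanSpace ℝ (Fin d))) : Prop :=
  ∀ x ∈ E, ∀ r : ℝ, 0 < r → ENNReal.ofReal r ≤ EMetric.diam E →
    ENNReal.ofReal (c₀⁻¹ * r ^ n) ≤ μH[(n : ℝ)] (ball x r ∩ E) ∧
      μH[(n : ℝ)] (ball x r ∩ E) ≤ ENNReal.ofReal (c₀ * r ^ n)

/-- `E ⊂ ℝ^d` is `n`-AD-regular. -/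
def ADRegular (n : ℕ) {d : ℕ} (E : Set (EuclideanSpace ℝ (Fin d))) : Prop :=
  ∃ c₀ : ℝ, 0 < c₀ ∧ ADRegularWith c₀ n E

/-- `E ⊂ ℝ^d` is uniformly `n`-rectifiable. -/
def UniformlyRectifiable (n : ℕ) {d : ℕ} (E : Set (EuclideanSpace ℝ (Fin d))) : Prop :=
  ADRegular n E ∧
    ∃ (θ : ℝ) (M : ℝ≥0), 0 < θ ∧ 0 < M ∧
      ∀ x ∈ E, ∀ r : ℝ, 0 < r → ENNReal.ofReal r ≤ EMetric.diam E →
        ∃ g : EuclideanSpace ℝ (Fin n) → EuclideanSpace ℝ (Fin d),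
          LipschitzWith M g ∧
            ENNReal.ofReal (θ * r ^ n) ≤ μH[(n : ℝ)] (E ∩ ball x r ∩ (g '' ball 0 r))

/-- `Ω ⊂ ℝ^d` is a corkscrew domain. -/
def Corkscrew {d : ℕ} (Ω : Set (EuclideanSpace ℝ (Fin d))) : Prop :=
  ∃ c : ℝ, 0 < c ∧
    ∀ x ∈ frontier Ω, ∀ r : ℝ, 0 < r → ENNReal.ofReal r ≤ EMetric.diam Ω →
      ∃ (x' : EuclideanSpace ℝ (Fin d)) (r' : ℝ),
        c * r ≤ r' ∧ ball x' r' ⊆ Ω ∩ ball x r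

/-- `u` is harmonic on `Ω`: it is `C²` there and its Laplacian vanishes. -/
def IsHarmonicOn {d : ℕ} (u : EuclideanSpace ℝ (Fin d) → ℝ)
    (Ω : Set (EuclideanSpace ℝ (Fin d))) : Prop :=
  ContDiffOn ℝ 2 u Ω ∧
    ∀ x ∈ Ω, (∑ i : Fin d,
      fderiv ℝ (fun y => fderiv ℝ u y (EuclideanSpace.single i (1 : ℝ))) x
        (EuclideanSpace.single i (1 : ℝ))) = 0

/-- `u` is `ε`-approximable on `Ω` (with the `W^{1,1}_loc` competitor `φ`
encoded via its distributional gradient `F`). -/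
def EpsApprox (n : ℕ) {d : ℕ} (Ω : Set (EuclideanSpace ℝ (Fin d)))
    (u : EuclideanSpace ℝ (Fin d) → ℝ) (ε : ℝ) : Prop :=
  ∃ (φ : EuclideanSpace ℝ (Fin d) → ℝ)
    (F : EuclideanSpace ℝ (Fin d) → EuclideanSpace ℝ (Fin d)) (C : ℝ),
    0 < C ∧ LocallyIntegrableOn φ Ω ∧ LocallyIntegrableOn F Ω ∧
    (∀ ψ : EuclideanSpace ℝ (Fin d) → ℝ, ContDiff ℝ (⊤ : ℕ∞) ψ →
        HasCompactSupport ψ → tsupport ψ ⊆ Ω →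
        ∫ x in Ω, φ x • gradient ψ x = -∫ x in Ω, ψ x • F x) ∧
    (∀ x ∈ Ω, |u x - φ x| < ε) ∧
    (∀ x ∈ frontier Ω, ∀ r : ℝ, 0 < r → ∫ y in ball x r ∩ Ω, ‖F y‖ ≤ C * r ^ n)

/-- The nontangential cone `Γ(x)`. -/
def cone {d : ℕ} (Ω : Set (EuclideanSpace ℝ (Fin d))) (x : EuclideanSpace ℝ (Fin d)) :
    Set (EuclideanSpace ℝ (Fin d)) :=
  {y | y ∈ Ω ∧ dist x y < 2 * infDist y (frontier Ω)}

/-- The nontangential maximal function `N_* u`. -/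
def ntMaximal {d : ℕ} (Ω : Set (EuclideanSpace ℝ (Fin d)))
    (u : EuclideanSpace ℝ (Fin d) → ℝ) (x : EuclideanSpace ℝ (Fin d)) : ℝ≥0∞ :=
  ⨆ y ∈ cone Ω x, (‖u y‖₊ : ℝ≥0∞)

/-- The square function `Su`. -/
def sqFun (n : ℕ) {d : ℕ} (Ω : Set (EuclideanSpace ℝ (Fin d)))
    (u : EuclideanSpace ℝ (Fin d) → ℝ) (x : EuclideanSpace ℝ (Fin d)) : ℝ≥0∞ :=
  (∫⁻ y in cone Ω x,
      (‖gradient u y‖₊ : ℝ≥0∞) ^ 2 *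
        ENNReal.ofReal (infDist y (frontier Ω) ^ ((1 : ℝ) - n))) ^ (1 / 2 : ℝ)

/-- `u ∈ C₀(closure Ω)`: continuous on the closure of `Ω` and vanishing at infinity. -/
def MemC0Closure {d : ℕ} (Ω : Set (EuclideanSpace ℝ (Fin d)))
    (u : EuclideanSpace ℝ (Fin d) → ℝ) : Prop :=
  ContinuousOn u (closure Ω) ∧
    Filter.Tendsto u (Filter.cocompact (EuclideanSpace ℝ (Fin d)) ⊓
      Filter.principal (closure Ω)) (nhds 0)

/-- The suppressed Riesz kernel `K_Φ`. -/
def suppKernel (n : ℕ) {d : ℕ} (Φ : EuclideanSpace ℝ (Fin d) → ℝ)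
    (x y : EuclideanSpace ℝ (Fin d)) : EuclideanSpace ℝ (Fin d) :=
  ((dist x y ^ 2 + Φ x * Φ y) ^ (((n : ℝ) + 1) / 2))⁻¹ • (x - y)

/-- The radius function `ρ_ν` associated with a measure `ν` and constant `C₀`. -/
def suppRadius (n : ℕ) {d : ℕ} (C₀ : ℝ) (ν : Measure (EuclideanSpace ℝ (Fin d)))
    (x : EuclideanSpace ℝ (Fin d)) : ℝ :=
  sSup {r : ℝ | 0 < r ∧ ENNReal.ofReal (C₀ * r ^ n) < ν (ball x r)}

/-- The support of a measure on `ℝ^d`. -/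
def measSupport {d : ℕ} (μ : Measure (EuclideanSpace ℝ (Fin d))) :
    Set (EuclideanSpace ℝ (Fin d)) :=
  {x | ∀ r : ℝ, 0 < r → 0 < μ (ball x r)}

/-- A measure `μ` on `ℝ^d` is `n`-AD-regular with constant `c₀`. -/
def ADRegularMeasureWith (c₀ : ℝ) (n : ℕ) {d : ℕ}
    (μ : Measure (EuclideanSpace ℝ (Fin d))) : Prop :=
  ∀ x ∈ measSupport μ, ∀ r : ℝ, 0 < r → ENNReal.ofReal r ≤ EMetric.diam (measSupport μ) →
    ENNReal.ofReal (c₀⁻¹ * r ^ n) ≤ μ (ball x r) ∧ μ (ball x r) ≤ ENNReal.ofReal (c₀ * r ^ n)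

/-- The normalized Newtonian-type potential of `μ` restricted to `B(y₀,r)`. -/
def newtonPot (n : ℕ) {d : ℕ} (μ : Measure (EuclideanSpace ℝ (Fin d)))
    (y₀ : EuclideanSpace ℝ (Fin d)) (r : ℝ) (x : EuclideanSpace ℝ (Fin d)) : ℝ :=
  ∫ y in ball y₀ r, (r * dist x y ^ (n - 1))⁻¹ ∂μ

/-- The auxiliary logarithmic potential in the plane. -/
def logPot (μ : Measure (EuclideanSpace ℝ (Fin 2))) (y₁ y₂ : EuclideanSpace ℝ (Fin 2))
    (r : ℝ) (x : EuclideanSpace ℝ (Fin 2)) : ℝ :=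
  (∫ y in ball y₁ r, (1 / r) * Real.log (1 / dist x y) ∂μ) -
    ((μ (ball y₁ r)).toReal / (μ (ball y₂ r)).toReal) *
      ∫ y in ball y₂ r, (1 / r) * Real.log (1 / dist x y) ∂μ

/-- A continuous weight which vanishes for `|t| ≤ ε` and equals one for `|t| ≥ 2 ε`. -/
def flatWeight (ε t : ℝ) : ℝ := max 0 (min 1 (|t| / ε - 1))

lemma continuous_flatWeight (ε : ℝ) : Continuous (flatWeight ε) := by
  unfold flatWeight; fun_prop

lemma flatWeight_nonneg (ε t : ℝ) : 0 ≤ flatWeight ε t := le_max_left _ _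

lemma flatWeight_le_one (ε t : ℝ) : flatWeight ε t ≤ 1 := by
  simp [flatWeight]

lemma flatWeight_eq_zero {ε t : ℝ} (hε : 0 < ε) (ht : |t| ≤ ε) : flatWeight ε t = 0 := by
  have : |t| / ε ≤ 1 := (div_le_one hε).2 ht
  exact max_eq_left ((min_le_right _ _).trans (by linarith))

lemma flatWeight_eq_one {ε t : ℝ} (hε : 0 < ε) (ht : 2 * ε ≤ |t|) : flatWeight ε t = 1 := by
  have : 2 ≤ |t| / ε := (le_div_iff₀ hε).2 ht
  rw [flatWeight, min_eq_left (by linarith), max_eq_right zero_le_one]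

/-- A convex `C²` function vanishing near zero with at most quadratic growth. -/
lemma exists_flat_convex {ε : ℝ} (hε : 0 < ε) :
    ∃ G : ℝ → ℝ, ContDiff ℝ 2 G ∧ (∀ t, deriv (deriv G) t = flatWeight ε t) ∧
      (∀ t, |t| ≤ ε → G t = 0) ∧ ∀ t, |G t| ≤ t ^ 2 := by
  set g : ℝ → ℝ := fun t => ∫ s in (0 : ℝ)..t, flatWeight ε s with hg
  have hg' : ∀ t, HasDerivAt g (flatWeight ε t) t := fun t =>
    ((continuous_flatWeight ε).integral_hasStrictDerivAt 0 t).hasDerivAt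
  have hgc : Continuous g := continuous_iff_continuousAt.2 fun t => (hg' t).continuousAt
  set G : ℝ → ℝ := fun t => ∫ s in (0 : ℝ)..t, g s with hG
  have hG' : ∀ t, HasDerivAt G (g t) t := fun t =>
    (hgc.integral_hasStrictDerivAt 0 t).hasDerivAt
  have hdg : deriv g = flatWeight ε := funext fun t => (hg' t).deriv
  have hdG : deriv G = g := funext fun t => (hG' t).deriv
  have hg1 : ContDiff ℝ 1 g :=
    contDiff_one_iff_deriv.2 ⟨fun t => (hg' t).differentiableAt, hdg ▸ continuous_flatWeight ε⟩
  have hmem : ∀ t s : ℝ, s ∈ uIoc 0 t → |s| ≤ |t| := by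
    intro t s hs
    rcases le_total 0 t with h | h
    · rw [uIoc_of_le h] at hs
      rw [abs_of_pos hs.1, abs_of_nonneg h]; exact hs.2
    · rw [uIoc_of_ge h] at hs
      rw [abs_of_nonpos hs.2, abs_of_nonpos h]; linarith [hs.1]
  have hgz : ∀ t, |t| ≤ ε → g t = 0 := fun t ht => by
    rw [hg]
    refine intervalIntegral.integral_zero_ae (ae_of_all _ fun s hs => ?_)
    exact flatWeight_eq_zero hε ((hmem t s hs).trans ht)
  have hgb : ∀ t, |g t| ≤ |t| := fun t => by
    have := intervalIntegral.norm_integral_le_of_norm_le_const (a := 0) (b := t) (C := 1)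
      (f := flatWeight ε) fun s _ => by
        rw [Real.norm_of_nonneg (flatWeight_nonneg _ _)]; exact flatWeight_le_one _ _
    simpa using this
  refine ⟨G, ?_, fun t => by rw [hdG, hdg], fun t ht => ?_, fun t => ?_⟩
  · rw [show (2 : WithTop ℕ∞) = 1 + 1 by norm_num, contDiff_succ_iff_deriv]
    exact ⟨fun t => (hG' t).differentiableAt, by simp, hdG ▸ hg1⟩
  · rw [hG]
    exact intervalIntegral.integral_zero_ae (ae_of_all _ fun s hs => hgz s ((hmem t s hs).trans ht))
  · have := intervalIntegral.norm_integral_le_of_norm_le_const (a := 0) (b := t) (C := |t|)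
      (f := g) fun s hs => (hgb s).trans (hmem t s hs)
    simpa [← sq] using this

/-- The Laplacian, as the sum of the second coordinate derivatives. -/
def coordLaplacian {d : ℕ} (f : EuclideanSpace ℝ (Fin d) → ℝ) (x : EuclideanSpace ℝ (Fin d)) : ℝ :=
  ∑ i : Fin d, fderiv ℝ (fun y => fderiv ℝ f y (EuclideanSpace.single i (1 : ℝ))) x
    (EuclideanSpace.single i (1 : ℝ))

section coordLaplacian

variable {d : ℕ} {f g : EuclideanSpace ℝ (Fin d) → ℝ} {x : EuclideanSpace ℝ (Fin d)}

lemma ContDiff.fderiv_apply_const (hf : ContDiff ℝ 2 f) (v : EuclideanSpace ℝ (Fin d)) :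
    ContDiff ℝ 1 fun y => fderiv ℝ f y v :=
  (hf.fderiv_right (m := 1) (by norm_num)).clm_apply contDiff_const

lemma ContDiff.continuous_coordLaplacian (hf : ContDiff ℝ 2 f) : Continuous (coordLaplacian f) :=
  continuous_finsetSum _ fun _ _ =>
    ((hf.fderiv_apply_const _).continuous_fderiv one_ne_zero).clm_apply continuous_const

lemma HasCompactSupport.coordLaplacian (hf : HasCompactSupport f) :
    HasCompactSupport (coordLaplacian f) := by
  refine hf.mono' fun x hx => ?_
  by_contra h
  refine hx (Finset.sum_eq_zero fun i _ => ?_)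
  have h1 : f =ᶠ[𝓝 x] 0 := notMem_tsupport_iff_eventuallyEq.1 h
  have h2 : (fun y => fderiv ℝ f y (EuclideanSpace.single i (1 : ℝ))) =ᶠ[𝓝 x] fun _ => 0 := by
    filter_upwards [h1.fderiv (𝕜 := ℝ)] with y hy
    rw [hy]; simp
  rw [h2.fderiv_eq]; simp

lemma Filter.EventuallyEq.coordLaplacian_eq (h : f =ᶠ[𝓝 x] g) :
    coordLaplacian f x = coordLaplacian g x := by
  refine Finset.sum_congr rfl fun i _ => ?_
  have : (fun y => fderiv ℝ f y (EuclideanSpace.single i (1 : ℝ))) =ᶠ[𝓝 x]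
      fun y => fderiv ℝ g y (EuclideanSpace.single i (1 : ℝ)) := by
    filter_upwards [h.fderiv (𝕜 := ℝ)] with y hy
    rw [hy]
  rw [this.fderiv_eq]

lemma coordLaplacian_zero : coordLaplacian (0 : EuclideanSpace ℝ (Fin d) → ℝ) x = 0 := by
  simp [coordLaplacian]

/-- Green's second identity for compactly supported `f`. -/
lemma integral_mul_coordLaplacian (hf : ContDiff ℝ 2 f) (hg : ContDiff ℝ 2 g)
    (hfs : HasCompactSupport f) :
    ∫ x, f x * coordLaplacian g x = ∫ x, coordLaplacian f x * g x := by
  simp only [coordLaplacian, Finset.mul_sum, Finset.sum_mul]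
  have key : ∀ i : Fin d, Integrable (fun x => f x * fderiv ℝ (fun y => fderiv ℝ g y
        (EuclideanSpace.single i (1 : ℝ))) x (EuclideanSpace.single i (1 : ℝ))) ∧
      Integrable (fun x => fderiv ℝ (fun y => fderiv ℝ f y
        (EuclideanSpace.single i (1 : ℝ))) x (EuclideanSpace.single i (1 : ℝ)) * g x) ∧
      ∫ x, f x * fderiv ℝ (fun y => fderiv ℝ g y
        (EuclideanSpace.single i (1 : ℝ))) x (EuclideanSpace.single i (1 : ℝ)) =
      ∫ x, fderiv ℝ (fun y => fderiv ℝ f y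
        (EuclideanSpace.single i (1 : ℝ))) x (EuclideanSpace.single i (1 : ℝ)) * g x := by
    intro i
    set e := EuclideanSpace.single i (1 : ℝ)
    have hf1 := hf.fderiv_apply_const e
    have hg1 := hg.fderiv_apply_const e
    have hf2 : Continuous fun x => fderiv ℝ (fun y => fderiv ℝ f y e) x e :=
      (hf1.continuous_fderiv one_ne_zero).clm_apply continuous_const
    have hg2 : Continuous fun x => fderiv ℝ (fun y => fderiv ℝ g y e) x e :=
      (hg1.continuous_fderiv one_ne_zero).clm_apply continuous_const
    have hs1 : HasCompactSupport fun y => fderiv ℝ f y e := hfs.fderiv_apply ℝ e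
    have hs2 : HasCompactSupport fun x => fderiv ℝ (fun y => fderiv ℝ f y e) x e :=
      hs1.fderiv_apply ℝ e
    have i1 : Integrable fun x => f x * fderiv ℝ (fun y => fderiv ℝ g y e) x e :=
      (hf.continuous.mul hg2).integrable_of_hasCompactSupport hfs.mul_right
    have i2 : Integrable fun x => fderiv ℝ (fun y => fderiv ℝ f y e) x e * g x :=
      (hf2.mul hg.continuous).integrable_of_hasCompactSupport hs2.mul_right
    have i3 : Integrable fun x => fderiv ℝ f x e * fderiv ℝ g x e :=
      (hf1.continuous.mul hg1.continuous).integrable_of_hasCompactSupport hs1.mul_right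
    have i4 : Integrable fun x => f x * fderiv ℝ g x e :=
      (hf.continuous.mul hg1.continuous).integrable_of_hasCompactSupport hfs.mul_right
    have i5 : Integrable fun x => fderiv ℝ f x e * g x :=
      (hf1.continuous.mul hg.continuous).integrable_of_hasCompactSupport hs1.mul_right
    refine ⟨i1, i2, ?_⟩
    rw [integral_mul_fderiv_eq_neg_fderiv_mul_of_integrable i3 i1 i4
      (fun x _ => hf.differentiable two_ne_zero x) (fun x _ => hg1.differentiable one_ne_zero x),
      integral_mul_fderiv_eq_neg_fderiv_mul_of_integrable i2 i3 i5
      (fun x _ => hf1.differentiable one_ne_zero x) (fun x _ => hg.differentiable two_ne_zero x),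
      neg_neg]
  rw [integral_finsetSum _ fun i _ => (key i).1, integral_finsetSum _ fun i _ => (key i).2.1]
  exact Finset.sum_congr rfl fun i _ => (key i).2.2

lemma norm_gradient_sq : ‖gradient f x‖ ^ 2 =
    ∑ i : Fin d, fderiv ℝ f x (EuclideanSpace.single i (1 : ℝ)) ^ 2 := by
  rw [EuclideanSpace.norm_sq_eq]
  refine Finset.sum_congr rfl fun i _ => ?_
  have : inner ℝ (gradient f x) (EuclideanSpace.single i (1 : ℝ)) =
      fderiv ℝ f x (EuclideanSpace.single i (1 : ℝ)) := by
    simp [gradient]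
  rw [← this, EuclideanSpace.inner_single_right]
  simp

/-- The chain rule for the Laplacian of a function of a harmonic function. -/
lemma coordLaplacian_comp {Ω : Set (EuclideanSpace ℝ (Fin d))} (hΩ : IsOpen Ω)
    (hf : ContDiffOn ℝ 2 f Ω) (hx : x ∈ Ω) (hfx : coordLaplacian f x = 0) {G : ℝ → ℝ}
    (hG : ContDiff ℝ 2 G) :
    coordLaplacian (G ∘ f) x = deriv (deriv G) (f x) * ‖gradient f x‖ ^ 2 := by
  have hG1 : ContDiff ℝ 1 (deriv G) := by
    rw [show (2 : WithTop ℕ∞) = 1 + 1 by norm_num, contDiff_succ_iff_deriv] at hG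
    exact hG.2.2
  have hfd : ∀ y ∈ Ω, HasFDerivAt f (fderiv ℝ f y) y := fun y hy =>
    ((hf.contDiffAt (hΩ.mem_nhds hy)).differentiableAt two_ne_zero).hasFDerivAt
  have hcomp : ∀ i : Fin d, fderiv ℝ (fun y => fderiv ℝ (G ∘ f) y
        (EuclideanSpace.single i (1 : ℝ))) x (EuclideanSpace.single i (1 : ℝ)) =
      deriv (deriv G) (f x) * fderiv ℝ f x (EuclideanSpace.single i (1 : ℝ)) ^ 2 +
      deriv G (f x) * fderiv ℝ (fun y => fderiv ℝ f y
        (EuclideanSpace.single i (1 : ℝ))) x (EuclideanSpace.single i (1 : ℝ)) := by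
    intro i
    set e := EuclideanSpace.single i (1 : ℝ)
    have h1 : (fun y => fderiv ℝ (G ∘ f) y e) =ᶠ[𝓝 x]
        fun y => deriv G (f y) * fderiv ℝ f y e := by
      filter_upwards [hΩ.mem_nhds hx] with y hy
      rw [(((hG.differentiable two_ne_zero) (f y)).hasDerivAt.comp_hasFDerivAt y
        (hfd y hy)).fderiv]
      simp
    have h2 : HasFDerivAt (fun y => deriv G (f y)) (deriv (deriv G) (f x) • fderiv ℝ f x) x :=
      ((hG1.differentiable one_ne_zero) (f x)).hasDerivAt.comp_hasFDerivAt x (hfd x hx)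
    have h3 : DifferentiableAt ℝ (fun y => fderiv ℝ f y e) x :=
      ((((hf.contDiffAt (hΩ.mem_nhds hx)).fderiv_right (m := 1) (by norm_num)).clm_apply
        contDiffAt_const).differentiableAt one_ne_zero)
    have h4 : HasFDerivAt (fun y => deriv G (f y) * fderiv ℝ f y e) _ x := h2.mul h3.hasFDerivAt
    rw [h1.fderiv_eq, h4.fderiv]
    simp
    ring
  rw [coordLaplacian, Finset.sum_congr rfl fun i _ => hcomp i, Finset.sum_add_distrib,
    ← Finset.mul_sum, ← Finset.mul_sum, norm_gradient_sq]
  rw [coordLaplacian] at hfx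
  rw [hfx]; ring

lemma coordLaplacian_comp_smul_sub (hf : ContDiff ℝ 2 f) (c : ℝ) (x₀ : EuclideanSpace ℝ (Fin d)) :
    coordLaplacian (fun y => f (c • (y - x₀))) x = c ^ 2 * coordLaplacian f (c • (x - x₀)) := by
  have key : ∀ (h : EuclideanSpace ℝ (Fin d) → ℝ), Differentiable ℝ h →
      ∀ y v, fderiv ℝ (fun y => h (c • (y - x₀))) y v = c * fderiv ℝ h (c • (y - x₀)) v := by
    intro h hh y v
    have h1 : HasFDerivAt (fun y => c • (y - x₀))
        (c • ContinuousLinearMap.id ℝ (EuclideanSpace ℝ (Fin d))) y :=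
      ((hasFDerivAt_id y).sub_const x₀).const_smul c
    have h2 : HasFDerivAt (fun y => h (c • (y - x₀))) _ y :=
      (hh (c • (y - x₀))).hasFDerivAt.comp y h1
    rw [h2.fderiv]; simp
  rw [coordLaplacian, coordLaplacian, Finset.mul_sum]
  refine Finset.sum_congr rfl fun i _ => ?_
  have hf1 := (hf.fderiv_apply_const (EuclideanSpace.single i (1 : ℝ))).differentiable one_ne_zero
  simp_rw [key f (hf.differentiable two_ne_zero)]
  rw [fderiv_const_mul, _root_.smul_apply, key _ hf1, smul_eq_mul]
  · ring
  · exact (hf1 _).comp x (by fun_prop)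

/-- The gradient vanishes almost everywhere on the zero set. -/
lemma ae_gradient_eq_zero_of_eq_zero {s : Set (EuclideanSpace ℝ (Fin d))} (hs : MeasurableSet s)
    (hf : ∀ x ∈ s, DifferentiableAt ℝ f x) (h0 : ∀ x ∈ s, f x = 0) :
    ∀ᵐ x ∂volume.restrict s, gradient f x = 0 := by
  have key : ∀ i : Fin d, ∀ᵐ x ∂volume.restrict s, fderiv ℝ f x = 0 := by
    intro i
    set e := EuclideanSpace.single i (1 : ℝ)
    have hA : ApproximatesLinearOn (fun x => f x • e)
        (0 : EuclideanSpace ℝ (Fin d) →L[ℝ] EuclideanSpace ℝ (Fin d)) s 0 := by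
      intro x hx y hy
      simp [h0 x hx, h0 y hy]
    filter_upwards [hA.norm_fderiv_sub_le volume hs (fun x => (fderiv ℝ f x).smulRight e)
      fun x hx => ((hf x hx).hasFDerivAt.smul_const e).hasFDerivWithinAt] with x hx
    simpa [e] using hx
  filter_upwards [ae_all_iff.2 key] with x hx
  have : ‖gradient f x‖ ^ 2 = 0 := by
    rw [norm_gradient_sq]
    refine Finset.sum_eq_zero fun i _ => ?_
    simp [hx i]
  simpa using this

end coordLaplacian

/-- Cutoff functions between concentric balls of radii `r` and `2 r`, with Laplacian `O(r⁻²)`. -/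
lemma exists_cutoff_coordLaplacian_le (d : ℕ) :
    ∃ K : ℝ, 0 < K ∧ ∀ (x₀ : EuclideanSpace ℝ (Fin d)) (r : ℝ), 0 < r →
      ∃ φ : EuclideanSpace ℝ (Fin d) → ℝ, ContDiff ℝ 2 φ ∧ (∀ x, 0 ≤ φ x) ∧
        (∀ x ∈ ball x₀ r, φ x = 1) ∧ tsupport φ ⊆ closedBall x₀ (2 * r) ∧
        ∀ x, |coordLaplacian φ x| ≤ K / r ^ 2 := by
  let b : ContDiffBump (0 : EuclideanSpace ℝ (Fin d)) := ⟨1, 2, one_pos, one_lt_two⟩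
  have hb : ContDiff ℝ 2 b := b.contDiff
  obtain ⟨K, hK⟩ := hb.continuous_coordLaplacian.bounded_above_of_compact_support
    b.hasCompactSupport.coordLaplacian
  refine ⟨max K 1, by positivity, fun x₀ r hr => ⟨fun x => b (r⁻¹ • (x - x₀)), ?_, fun x => b.nonneg,
    fun x hx => b.one_of_mem_closedBall ?_, ?_, fun x => ?_⟩⟩
  · exact hb.comp (by fun_prop)
  · rw [mem_closedBall_zero_iff, norm_smul, norm_inv, Real.norm_of_nonneg hr.le, ← dist_eq_norm,
      inv_mul_le_iff₀ hr]
    change dist x x₀ ≤ r * 1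
    rw [mul_one]; exact (mem_ball.1 hx).le
  · refine closure_minimal (fun x hx => ?_) isClosed_closedBall
    have h : r⁻¹ • (x - x₀) ∈ Function.support b := hx
    rw [b.support_eq, mem_ball_zero_iff, norm_smul, norm_inv, Real.norm_of_nonneg hr.le,
      ← dist_eq_norm, inv_mul_lt_iff₀ hr] at h
    rw [mem_closedBall, mul_comm]
    exact h.le
  · rw [coordLaplacian_comp_smul_sub hb, abs_mul, abs_of_nonneg (by positivity), inv_pow,
      div_eq_inv_mul]
    gcongr
    exact (hK _).trans (le_max_left _ _)

section

variable {d : ℕ} {Ω : Set (EuclideanSpace ℝ (Fin d))} {u : EuclideanSpace ℝ (Fin d) → ℝ}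

/-- A function continuous on `closure Ω` and vanishing at `x ∈ frontier Ω`, composed with a function
vanishing near zero and extended by zero, vanishes near `x`. -/
lemma indicator_comp_eventuallyEq_zero {x : EuclideanSpace ℝ (Fin d)} (hΩ : IsOpen Ω)
    (huc : ContinuousOn u (closure Ω)) (hx : x ∉ Ω) (hux : x ∈ frontier Ω → u x = 0)
    {ε : ℝ} (hε : 0 < ε) {G : ℝ → ℝ} (hG : ∀ t, |t| ≤ ε → G t = 0) :
    Ω.indicator (G ∘ u) =ᶠ[𝓝 x] 0 := by
  by_cases hxc : x ∈ closure Ω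
  · have hxf : x ∈ frontier Ω := by rw [hΩ.frontier_eq]; exact ⟨hxc, hx⟩
    have h1 : ∀ᶠ y in 𝓝[closure Ω] x, |u y| < ε := by
      refine (huc x hxc).abs.eventually_lt_const ?_
      simpa [hux hxf] using hε
    filter_upwards [eventually_nhdsWithin_iff.1 h1] with y hy
    by_cases hyΩ : y ∈ Ω
    · simpa [hyΩ] using hG _ (hy (subset_closure hyΩ)).le
    · simp [hyΩ]
  · filter_upwards [isClosed_closure.isOpen_compl.mem_nhds hxc] with y hy
    exact indicator_of_notMem (fun h => hy (subset_closure h)) _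

/-- Caccioppoli's inequality for a weighted energy, the weight vanishing where `u` is small. -/
lemma lintegral_flatWeight_mul_norm_gradient_sq_le (hΩ : IsOpen Ω) (hu : IsHarmonicOn u Ω)
    (huc : ContinuousOn u (closure Ω)) {x₀ : EuclideanSpace ℝ (Fin d)} {r M L : ℝ} (hr : 0 < r)
    (hM : ∀ x ∈ Ω, |u x| ≤ M) (h0 : ∀ x ∈ frontier Ω ∩ ball x₀ (5 / 2 * r), u x = 0)
    {φ : EuclideanSpace ℝ (Fin d) → ℝ} (hφ : ContDiff ℝ 2 φ) (hφ0 : ∀ x, 0 ≤ φ x)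
    (hφ1 : ∀ x ∈ ball x₀ r, φ x = 1) (hφs : tsupport φ ⊆ closedBall x₀ (2 * r))
    (hφL : ∀ x, |coordLaplacian φ x| ≤ L) {ε : ℝ} (hε : 0 < ε) :
    ∫⁻ x in ball x₀ r ∩ Ω, ENNReal.ofReal (flatWeight ε (u x) * ‖gradient u x‖ ^ 2) ≤
      ENNReal.ofReal (L * M ^ 2 * volume.real (closedBall x₀ (2 * r))) := by
  obtain ⟨G, hG, hG2, hGz, hGb⟩ := exists_flat_convex hε
  have hφc : HasCompactSupport φ := (isCompact_closedBall x₀ (2 * r)).of_isClosed_subset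
    (isClosed_tsupport φ) hφs
  let χ : ContDiffBump x₀ := ⟨9 / 4 * r, 19 / 8 * r, by positivity, by linarith⟩
  set w : EuclideanSpace ℝ (Fin d) → ℝ := Ω.indicator (G ∘ u) with hw
  set W : EuclideanSpace ℝ (Fin d) → ℝ := fun x => χ x * w x with hWdef
  have hwΩ : ∀ x ∈ Ω, w =ᶠ[𝓝 x] G ∘ u := fun x hx => by
    filter_upwards [hΩ.mem_nhds hx] with y hy
    exact indicator_of_mem hy _
  have hw0 : ∀ x ∈ ball x₀ (5 / 2 * r), x ∉ Ω → w =ᶠ[𝓝 x] 0 := fun x hx hxΩ =>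
    indicator_comp_eventuallyEq_zero hΩ huc hxΩ (fun h => h0 x ⟨h, hx⟩) hε hGz
  have hW : ContDiff ℝ 2 W := by
    refine contDiff_iff_contDiffAt.2 fun x => ?_
    by_cases hx : x ∈ ball x₀ (5 / 2 * r)
    · refine χ.contDiffAt.mul ?_
      by_cases hxΩ : x ∈ Ω
      · exact (hG.contDiffAt.comp x (hu.1.contDiffAt (hΩ.mem_nhds hxΩ))).congr_of_eventuallyEq
          (hwΩ x hxΩ)
      · exact contDiffAt_const.congr_of_eventuallyEq (hw0 x hx hxΩ)
    · have hx' : x ∉ tsupport χ := by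
        rw [χ.tsupport_eq, mem_closedBall]
        rw [mem_ball] at hx
        change ¬ dist x x₀ ≤ 19 / 8 * r
        linarith
      refine (contDiffAt_const (c := (0 : ℝ))).congr_of_eventuallyEq ?_
      filter_upwards [notMem_tsupport_iff_eventuallyEq.1 hx'] with y hy
      simp [hWdef, hy]
  have hWw : ∀ x ∈ ball x₀ (9 / 4 * r), W =ᶠ[𝓝 x] w := fun x hx => by
    filter_upwards [isOpen_ball.mem_nhds hx] with y hy
    simp [hWdef, χ.one_of_mem_closedBall (ball_subset_closedBall hy)]
  have hlapΩ : ∀ x ∈ Ω, x ∈ ball x₀ (9 / 4 * r) →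
      coordLaplacian W x = flatWeight ε (u x) * ‖gradient u x‖ ^ 2 := fun x hx hxb => by
    rw [((hWw x hxb).trans (hwΩ x hx)).coordLaplacian_eq,
      coordLaplacian_comp hΩ hu.1 hx (hu.2 x hx) hG, hG2]
  have hlap0 : ∀ x ∉ Ω, x ∈ ball x₀ (9 / 4 * r) → coordLaplacian W x = 0 := fun x hx hxb => by
    rw [((hWw x hxb).trans
      (hw0 x (ball_subset_ball (by linarith) hxb) hx)).coordLaplacian_eq, coordLaplacian_zero]
  have hnonneg : ∀ x, 0 ≤ φ x * coordLaplacian W x := fun x => by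
    by_cases hx : x ∈ closedBall x₀ (2 * r)
    · have hxb : x ∈ ball x₀ (9 / 4 * r) := closedBall_subset_ball (by linarith) hx
      refine mul_nonneg (hφ0 x) ?_
      by_cases hxΩ : x ∈ Ω
      · rw [hlapΩ x hxΩ hxb]
        exact mul_nonneg (flatWeight_nonneg _ _) (sq_nonneg _)
      · rw [hlap0 x hxΩ hxb]
    · rw [image_eq_zero_of_notMem_tsupport fun h => hx (hφs h), zero_mul]
  have hint : Integrable fun x => φ x * coordLaplacian W x :=
    (hφ.continuous.mul hW.continuous_coordLaplacian).integrable_of_hasCompactSupport hφc.mul_right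
  have hWb : ∀ x, |W x| ≤ M ^ 2 := fun x => by
    rw [hWdef, abs_mul, abs_of_nonneg χ.nonneg]
    refine (mul_le_of_le_one_left (abs_nonneg _) χ.le_one).trans ?_
    by_cases hx : x ∈ Ω
    · rw [hw, indicator_of_mem hx]
      exact (hGb _).trans (sq_le_sq' (neg_le_of_abs_le (hM x hx)) (le_of_abs_le (hM x hx)))
    · simpa [hw, hx] using sq_nonneg M
  have hsub : Function.support (fun x => coordLaplacian φ x * W x) ⊆ closedBall x₀ (2 * r) := by
    intro x hx
    by_contra h
    have h1 : φ =ᶠ[𝓝 x] 0 := notMem_tsupport_iff_eventuallyEq.1 fun h' => h (hφs h')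
    exact hx (by simp [h1.coordLaplacian_eq, coordLaplacian_zero])
  calc ∫⁻ x in ball x₀ r ∩ Ω, ENNReal.ofReal (flatWeight ε (u x) * ‖gradient u x‖ ^ 2)
      = ∫⁻ x in ball x₀ r ∩ Ω, ENNReal.ofReal (φ x * coordLaplacian W x) := by
        refine setLIntegral_congr_fun (measurableSet_ball.inter hΩ.measurableSet) fun x hx => ?_
        simp only [hφ1 x hx.1, hlapΩ x hx.2 (ball_subset_ball (by linarith) hx.1), one_mul]
    _ ≤ ∫⁻ x, ENNReal.ofReal (φ x * coordLaplacian W x) := setLIntegral_le_lintegral _ _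
    _ = ENNReal.ofReal (∫ x, φ x * coordLaplacian W x) :=
        (ofReal_integral_eq_lintegral_ofReal hint (ae_of_all _ hnonneg)).symm
    _ ≤ _ := by
        refine ENNReal.ofReal_le_ofReal ?_
        rw [integral_mul_coordLaplacian hφ hW hφc, ← setIntegral_eq_integral_of_forall_compl_eq_zero
          (s := closedBall x₀ (2 * r)) fun x hx => Function.notMem_support.1 fun h => hx (hsub h)]
        refine (Real.le_norm_self _).trans (norm_setIntegral_le_of_norm_le_const
          measure_closedBall_lt_top fun x _ => ?_)
        rw [norm_mul, Real.norm_eq_abs, Real.norm_eq_abs]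
        exact mul_le_mul (hφL x) (hWb x) (abs_nonneg _) ((abs_nonneg _).trans (hφL x))

/-- Caccioppoli's inequality up to the boundary. -/
lemma lintegral_norm_gradient_sq_le (hΩ : IsOpen Ω) (hu : IsHarmonicOn u Ω)
    (huc : ContinuousOn u (closure Ω)) {x₀ : EuclideanSpace ℝ (Fin d)} {r M L : ℝ} (hr : 0 < r)
    (hM : ∀ x ∈ Ω, |u x| ≤ M) (h0 : ∀ x ∈ frontier Ω ∩ ball x₀ (5 / 2 * r), u x = 0)
    {φ : EuclideanSpace ℝ (Fin d) → ℝ} (hφ : ContDiff ℝ 2 φ) (hφ0 : ∀ x, 0 ≤ φ x)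
    (hφ1 : ∀ x ∈ ball x₀ r, φ x = 1) (hφs : tsupport φ ⊆ closedBall x₀ (2 * r))
    (hφL : ∀ x, |coordLaplacian φ x| ≤ L) :
    ∫⁻ x in ball x₀ r ∩ Ω, ENNReal.ofReal (‖gradient u x‖ ^ 2) ≤
      ENNReal.ofReal (L * M ^ 2 * volume.real (closedBall x₀ (2 * r))) := by
  set S := ball x₀ r ∩ Ω with hS
  have hSm : MeasurableSet S := measurableSet_ball.inter hΩ.measurableSet
  have hSΩ : S ⊆ Ω := inter_subset_right
  have huS : ContinuousOn u S := huc.mono (hSΩ.trans subset_closure)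
  have hgS : ContinuousOn (gradient u) S :=
    ((InnerProductSpace.toDual ℝ _).symm.continuous.comp_continuousOn
      (hu.1.continuousOn_fderiv_of_isOpen hΩ one_le_two)).mono hSΩ
  set F : ℕ → EuclideanSpace ℝ (Fin d) → ℝ≥0∞ := fun k x =>
    ENNReal.ofReal (flatWeight (1 / ((k : ℝ) + 1)) (u x) * ‖gradient u x‖ ^ 2) with hF
  have hFm : ∀ k, AEMeasurable (F k) (volume.restrict S) := fun k =>
    ((((continuous_flatWeight _).comp_continuousOn huS).mul
      (hgS.norm.pow 2)).aemeasurable hSm).ennreal_ofReal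
  have hzero : ∀ᵐ x ∂volume.restrict S, u x = 0 → gradient u x = 0 := by
    have hZm : MeasurableSet (S ∩ u ⁻¹' {0}) := by
      obtain ⟨v, hv, hve⟩ := continuousOn_iff_isClosed.1 huS _ (isClosed_singleton (x := (0 : ℝ)))
      rw [inter_comm, hve]
      exact hv.measurableSet.inter hSm
    have hZ := ae_gradient_eq_zero_of_eq_zero hZm (f := u)
      (fun x hx => (hu.1.contDiffAt (hΩ.mem_nhds (hSΩ hx.1))).differentiableAt two_ne_zero)
      fun x hx => hx.2
    rw [ae_restrict_iff' hZm] at hZ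
    rw [ae_restrict_iff' hSm]
    filter_upwards [hZ] with x hx hxS hx0 using hx ⟨hxS, hx0⟩
  have hlim : ∀ᵐ x ∂volume.restrict S,
      ENNReal.ofReal (‖gradient u x‖ ^ 2) = liminf (fun k => F k x) atTop := by
    filter_upwards [hzero] with x hx
    refine (Tendsto.liminf_eq ?_).symm
    refine tendsto_const_nhds.congr' ?_
    by_cases hux : u x = 0
    · exact Eventually.of_forall fun k => by simp [hF, hx hux]
    · have : ∀ᶠ k : ℕ in atTop, 1 / ((k : ℝ) + 1) < |u x| / 2 :=
        tendsto_one_div_add_atTop_nhds_zero_nat.eventually_lt_const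
          (half_pos (abs_pos.2 hux))
      filter_upwards [this] with k hk
      simp only [hF]
      rw [flatWeight_eq_one Nat.one_div_pos_of_nat (by linarith), one_mul]
  rw [lintegral_congr_ae hlim]
  refine (lintegral_liminf_le' hFm).trans ?_
  refine (liminf_le_liminf (Eventually.of_forall fun k : ℕ =>
    lintegral_flatWeight_mul_norm_gradient_sq_le hΩ hu huc hr hM h0 hφ hφ0 hφ1 hφs hφL
      (ε := 1 / ((k : ℝ) + 1)) Nat.one_div_pos_of_nat)).trans ?_
  simp

end

/-- Caccioppoli-type Carleson estimate for a bounded harmonic function,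
continuous up to the boundary, that vanishes on `∂Ω ∩ (5/2)B`. -/
theorem caccioppoli_carleson
    (n : ℕ) (hn : 1 ≤ n) (c₀ : ℝ) (hc₀ : 0 < c₀) :
    ∃ C : ℝ, 0 < C ∧
      ∀ Ω : Set (EuclideanSpace ℝ (Fin (n + 1))), IsOpen Ω →
        ADRegularWith c₀ n (frontier Ω) →
        ∀ x₀ ∈ frontier Ω, ∀ r : ℝ, 0 < r →
          ∀ (u : EuclideanSpace ℝ (Fin (n + 1)) → ℝ) (M : ℝ),
            IsHarmonicOn u Ω → ContinuousOn u (closure Ω) →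
            (∀ x ∈ Ω, |u x| ≤ M) →
            (∀ x ∈ frontier Ω ∩ ball x₀ (5 / 2 * r), u x = 0) →
            ∫ x in ball x₀ r ∩ Ω, ‖gradient u x‖ ^ 2 * infDist x (frontier Ω) ≤
              C * M ^ 2 * r ^ n := by
  obtain ⟨K, hK, hcut⟩ := exists_cutoff_coordLaplacian_le (n + 1)
  set V : ℝ := volume.real (ball (0 : EuclideanSpace ℝ (Fin (n + 1))) 1)
  have hV : 0 ≤ V := measureReal_nonneg
  refine ⟨K * 2 ^ (n + 1) * V + 1, by positivity, fun Ω hΩ _ x₀ hx₀ r hr u M hu huc hM h0 => ?_⟩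
  obtain ⟨φ, hφ, hφ0, hφ1, hφs, hφL⟩ := hcut x₀ r hr
  have hmain := lintegral_norm_gradient_sq_le hΩ hu huc hr hM h0 hφ hφ0 hφ1 hφs hφL
  have hvol : volume.real (closedBall x₀ (2 * r)) = (2 * r) ^ (n + 1) * V := by
    rw [Measure.addHaar_real_closedBall volume x₀ (by positivity), finrank_euclideanSpace_fin]
  rw [hvol] at hmain
  refine (Real.le_norm_self _).trans ((norm_integral_le_lintegral_norm _).trans ?_)
  refine ENNReal.toReal_le_of_le_ofReal (by positivity) ?_
  calc ∫⁻ x in ball x₀ r ∩ Ω, ENNReal.ofReal ‖‖gradient u x‖ ^ 2 * infDist x (frontier Ω)‖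
      ≤ ∫⁻ x in ball x₀ r ∩ Ω, ENNReal.ofReal r * ENNReal.ofReal (‖gradient u x‖ ^ 2) := by
        refine setLIntegral_mono' (measurableSet_ball.inter hΩ.measurableSet) fun x hx => ?_
        rw [← ENNReal.ofReal_mul hr.le, Real.norm_of_nonneg (mul_nonneg (sq_nonneg _)
          infDist_nonneg), mul_comm]
        gcongr
        exact (infDist_le_dist_of_mem hx₀).trans (mem_ball.1 hx.1).le
    _ = ENNReal.ofReal r * ∫⁻ x in ball x₀ r ∩ Ω, ENNReal.ofReal (‖gradient u x‖ ^ 2) :=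
        lintegral_const_mul' _ _ ENNReal.ofReal_ne_top
    _ ≤ ENNReal.ofReal r * ENNReal.ofReal (K / r ^ 2 * M ^ 2 * ((2 * r) ^ (n + 1) * V)) := by
        gcongr
    _ ≤ ENNReal.ofReal ((K * 2 ^ (n + 1) * V + 1) * M ^ 2 * r ^ n) := by
        rw [← ENNReal.ofReal_mul hr.le]
        refine ENNReal.ofReal_le_ofReal ?_
        have h : r * (K / r ^ 2 * M ^ 2 * ((2 * r) ^ (n + 1) * V)) =
            K * 2 ^ (n + 1) * V * M ^ 2 * r ^ n := by
          field_simp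
          ring
        rw [h]
        gcongr
        linarith
end
end

section
/- Let n ≥ 1 and let Φ : ℝ^{n+1} → [0,∞) be a 1-Lipschitz function. Define the suppressed Riesz kernel K_Φ(x,y) = (x−y)/(|x−y|² + Φ(x)Φ(y))^{(n+1)/2}. Then there is a constant C depending only on n such that for all x ≠ y: |K_Φ(x,y)| ≤ C/|x−y|ⁿ, and moreover |K_Φ(x,y)| ≤ C/Φ(x)ⁿ whenever Φ(x) > 0, and |K_Φ(x,y)| ≤ C/Φ(y)ⁿ whenever Φ(y) > 0. -/
open Metric MeasureTheory Set Filter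
open scoped ENNReal NNReal Topology

noncomputable section

theorem norm_suppKernel_le_div_pow (n : ℕ) {d : ℕ} {Φ : EuclideanSpace ℝ (Fin d) → ℝ}
    {x y : EuclideanSpace ℝ (Fin d)} (hΦ : 0 ≤ Φ x * Φ y) (hxy : x ≠ y) {s : ℝ} (hs : 0 < s)
    (hsQ : s ^ 2 ≤ 4 * (dist x y ^ 2 + Φ x * Φ y)) :
    ‖suppKernel n Φ x y‖ ≤ 2 ^ n / s ^ n := by
  have ht : 0 < dist x y := dist_pos.2 hxy
  set Q := dist x y ^ 2 + Φ x * Φ y with hQ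
  have hQ0 : 0 < Q := by positivity
  have hr : 0 < √Q := Real.sqrt_pos.2 hQ0
  have hrs : √Q ^ 2 = Q := Real.sq_sqrt hQ0.le
  have htr : dist x y ≤ √Q := Real.le_sqrt_of_sq_le (by linarith)
  have hsr : s ≤ 2 * √Q := by
    refine le_of_sq_le_sq ?_ (by positivity)
    rw [mul_pow, hrs]
    linarith
  have hpow : Q ^ (((n : ℝ) + 1) / 2) = √Q ^ (n + 1) := by
    rw [Real.sqrt_eq_rpow, ← Real.rpow_natCast, ← Real.rpow_mul hQ0.le]
    congr 1
    push_cast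
    ring
  rw [suppKernel, norm_smul, ← dist_eq_norm, ← hQ, hpow, norm_inv, Real.norm_eq_abs,
    abs_of_pos (by positivity), inv_mul_eq_div, div_le_div_iff₀ (by positivity) (by positivity)]
  calc dist x y * s ^ n ≤ √Q * (2 * √Q) ^ n := by gcongr
    _ = 2 ^ n * √Q ^ (n + 1) := by ring

/-- A `1`-Lipschitz function satisfies `Φ(x)² ≲ |x - y|² + Φ(x)Φ(y)`. -/
theorem LipschitzWith.sq_le_four_mul_dist_sq_add_mul {X : Type*} [PseudoMetricSpace X]
    {Φ : X → ℝ} (hLip : LipschitzWith 1 Φ) {x : X} (hx : 0 ≤ Φ x) (y : X) :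
    Φ x ^ 2 ≤ 4 * (dist x y ^ 2 + Φ x * Φ y) := by
  have h : Φ x - Φ y ≤ dist x y := by
    have := hLip.dist_le_mul x y
    rw [NNReal.coe_one, one_mul, Real.dist_eq] at this
    exact (le_abs_self _).trans this
  nlinarith [mul_le_mul_of_nonneg_left h hx, sq_nonneg (Φ x - 2 * dist x y)]

/-- size estimates for the suppressed Riesz kernel `K_Φ`. -/
theorem suppressed_kernel_size
    (n : ℕ) (hn : 1 ≤ n) :
    ∃ C : ℝ, 0 < C ∧
      ∀ Φ : EuclideanSpace ℝ (Fin (n + 1)) → ℝ,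
        LipschitzWith 1 Φ → (∀ x, 0 ≤ Φ x) →
        ∀ x y : EuclideanSpace ℝ (Fin (n + 1)), x ≠ y →
          ‖suppKernel n Φ x y‖ ≤ C / dist x y ^ n ∧
          (0 < Φ x → ‖suppKernel n Φ x y‖ ≤ C / Φ x ^ n) ∧
          (0 < Φ y → ‖suppKernel n Φ x y‖ ≤ C / Φ y ^ n) := by
  refine ⟨2 ^ n, by positivity, fun Φ hLip hΦ x y hxy => ?_⟩
  have hm : 0 ≤ Φ x * Φ y := mul_nonneg (hΦ x) (hΦ y)
  refine ⟨norm_suppKernel_le_div_pow n hm hxy (dist_pos.2 hxy) ?_,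
    fun hx => norm_suppKernel_le_div_pow n hm hxy hx
      (hLip.sq_le_four_mul_dist_sq_add_mul hx.le y),
    fun hy => norm_suppKernel_le_div_pow n hm hxy hy ?_⟩
  · nlinarith [sq_nonneg (dist x y)]
  · rw [dist_comm, mul_comm (Φ x)]
    exact hLip.sq_le_four_mul_dist_sq_add_mul hy.le x
end
end

section
/- Let n ≥ 1 and let Φ : ℝ^{n+1} → [0,∞) be a 1-Lipschitz function, and let K_Φ(x,y) = (x−y)/(|x−y|² + Φ(x)Φ(y))^{(n+1)/2} be the suppressed Riesz kernel. Then there is a constant C depending only on n such that |K_Φ(x,y) − K_Φ(x',y)| ≤ C |x−x'| / |x−y|^{n+1} whenever 2|x−x'| ≤ |x−y|, and by antisymmetry of the kernel the analogous estimate holds in the y-variable. -/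
open Metric MeasureTheory Set Filter
open scoped ENNReal NNReal Topology

noncomputable section

theorem suppKernel_antisymm (n : ℕ) {d : ℕ} (Φ : EuclideanSpace ℝ (Fin d) → ℝ)
    (x y : EuclideanSpace ℝ (Fin d)) : suppKernel n Φ x y = -suppKernel n Φ y x := by
  unfold suppKernel
  rw [dist_comm, mul_comm (Φ x), ← smul_neg, neg_sub]

theorem suppKernel_eq_sqrt_pow (n : ℕ) {d : ℕ} {Φ : EuclideanSpace ℝ (Fin d) → ℝ}
    (hΦ : ∀ x, 0 ≤ Φ x) (x y : EuclideanSpace ℝ (Fin d)) :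
    suppKernel n Φ x y = (√(dist x y ^ 2 + Φ x * Φ y) ^ (n + 1))⁻¹ • (x - y) := by
  have h : 0 ≤ dist x y ^ 2 + Φ x * Φ y :=
    add_nonneg (sq_nonneg _) (mul_nonneg (hΦ x) (hΦ y))
  unfold suppKernel
  rw [Real.sqrt_eq_rpow, ← Real.rpow_natCast _ (n + 1), ← Real.rpow_mul h]
  congr 3
  push_cast
  ring

theorem abs_inv_pow_sub_inv_pow_le {a b m h : ℝ} (N : ℕ) (hm : 0 < m) (ha : m ≤ a)
    (hb : m ≤ b) (hab : |a ^ 2 - b ^ 2| ≤ 6 * h * m) :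
    |(a ^ (N + 1))⁻¹ - (b ^ (N + 1))⁻¹| ≤ 3 * (N + 1) * h * (m ^ (N + 2))⁻¹ := by
  have ha0 : 0 < a := hm.trans_le ha
  have hb0 : 0 < b := hm.trans_le hb
  have hdiff : |a - b| ≤ 3 * h := by
    have h1 : |a ^ 2 - b ^ 2| = |a - b| * (a + b) := by
      rw [← abs_of_pos (add_pos ha0 hb0), ← abs_mul]
      congr 1
      ring
    have h2 : |a - b| * (2 * m) ≤ |a - b| * (a + b) :=
      mul_le_mul_of_nonneg_left (by linarith) (abs_nonneg _)
    have h3 : |a - b| * m ≤ 3 * h * m := by linarith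
    exact le_of_mul_le_mul_right h3 hm
  have hh : 0 ≤ h := by linarith [abs_nonneg (a - b)]
  have hinv : |a⁻¹ - b⁻¹| ≤ 3 * h * (m ^ 2)⁻¹ := by
    have h1 : a⁻¹ - b⁻¹ = (b - a) * (a * b)⁻¹ := by
      field_simp
    rw [h1, abs_mul, abs_sub_comm, abs_of_pos (inv_pos.mpr (mul_pos ha0 hb0)), sq]
    gcongr
  have hpow := abs_pow_sub_pow_le a⁻¹ b⁻¹ (N + 1)
  have hmax : max |a⁻¹| |b⁻¹| ≤ m⁻¹ := by
    rw [abs_of_pos (inv_pos.mpr ha0), abs_of_pos (inv_pos.mpr hb0)]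
    exact max_le (by gcongr) (by gcongr)
  rw [← inv_pow, ← inv_pow]
  calc |a⁻¹ ^ (N + 1) - b⁻¹ ^ (N + 1)|
      ≤ |a⁻¹ - b⁻¹| * ((N + 1 : ℕ) : ℝ) * max |a⁻¹| |b⁻¹| ^ N := hpow
    _ ≤ 3 * h * (m ^ 2)⁻¹ * ((N + 1 : ℕ) : ℝ) * m⁻¹ ^ N := by
        gcongr
    _ = 3 * (N + 1) * h * (m ^ (N + 2))⁻¹ := by
        push_cast
        rw [pow_add, mul_inv, inv_pow]
        ring

theorem le_two_mul_sqrt_of_le_add {r s t : ℝ} (ht : 0 ≤ t)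
    (hst : t ≤ s + r) : t ≤ 2 * √(r ^ 2 + s * t) := by
  have h : (t / 2) ^ 2 ≤ r ^ 2 + s * t := by
    nlinarith [mul_le_mul_of_nonneg_right hst ht, sq_nonneg (r - t / 2), sq_nonneg t]
  have := Real.le_sqrt_of_sq_le h
  linarith

theorem suppKernel_sub_left_le (n : ℕ) {d : ℕ} {Φ : EuclideanSpace ℝ (Fin d) → ℝ}
    (hL : LipschitzWith 1 Φ) (hΦ : ∀ x, 0 ≤ Φ x) {x x' y : EuclideanSpace ℝ (Fin d)}
    (hxy : x ≠ y) (hx' : 2 * dist x x' ≤ dist x y) :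
    ‖suppKernel n Φ x y - suppKernel n Φ x' y‖ ≤
      (1 + 6 * (n + 1) * 2 ^ (n + 1)) * dist x x' / dist x y ^ (n + 1) := by
  have lip : ∀ u v, |Φ u - Φ v| ≤ dist u v := fun u v => by
    simpa [Real.dist_eq] using hL.dist_le_mul u v
  rw [suppKernel_eq_sqrt_pow n hΦ, suppKernel_eq_sqrt_pow n hΦ]
  have hr : 0 < dist x y := dist_pos.mpr hxy
  have hh : 0 ≤ dist x x' := dist_nonneg
  have tri₁ : dist x y ≤ dist x x' + dist x' y := dist_triangle _ _ _
  have tri₂ : dist x' y ≤ dist x x' + dist x y := dist_triangle_left _ _ _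
  have hty : Φ y ≤ 2 * √(dist x y ^ 2 + Φ x * Φ y) :=
    le_two_mul_sqrt_of_le_add (hΦ y) (by linarith [(abs_le.mp (lip x y)).1])
  have hty' : Φ y ≤ 2 * √(dist x' y ^ 2 + Φ x' * Φ y) :=
    le_two_mul_sqrt_of_le_add (hΦ y) (by linarith [(abs_le.mp (lip x' y)).1])
  have hA : 0 ≤ Φ x * Φ y := mul_nonneg (hΦ x) (hΦ y)
  have hB : 0 ≤ Φ x' * Φ y := mul_nonneg (hΦ x') (hΦ y)
  have hra : dist x y ≤ √(dist x y ^ 2 + Φ x * Φ y) := Real.le_sqrt_of_sq_le (by linarith)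
  have hrb : dist x' y ≤ √(dist x' y ^ 2 + Φ x' * Φ y) := Real.le_sqrt_of_sq_le (by linarith)
  have ha2 := Real.sq_sqrt (add_nonneg (sq_nonneg (dist x y)) hA)
  have hb2 := Real.sq_sqrt (add_nonneg (sq_nonneg (dist x' y)) hB)
  set a := √(dist x y ^ 2 + Φ x * Φ y)
  set b := √(dist x' y ^ 2 + Φ x' * Φ y)
  set m := min a b
  have hma : m ≤ a := min_le_left _ _
  have hmb : m ≤ b := min_le_right _ _
  have hrm : dist x y / 2 ≤ m := le_min (by linarith) (by linarith)
  have hrm' : dist x' y / 2 ≤ m := le_min (by linarith) (by linarith)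
  have htm : Φ y / 2 ≤ m := le_min (by linarith) (by linarith)
  have hm : 0 < m := by linarith
  have hab : |a ^ 2 - b ^ 2| ≤ 6 * dist x x' * m := by
    have hsplit : a ^ 2 - b ^ 2 =
        (dist x y - dist x' y) * (dist x y + dist x' y) + (Φ x - Φ x') * Φ y := by
      rw [ha2, hb2]
      ring
    have hd : |dist x y - dist x' y| ≤ dist x x' := abs_le.mpr ⟨by linarith, by linarith⟩
    calc |a ^ 2 - b ^ 2|
        ≤ |dist x y - dist x' y| * (dist x y + dist x' y) + |Φ x - Φ x'| * Φ y := by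
          rw [hsplit]
          refine (abs_add_le _ _).trans_eq ?_
          rw [abs_mul, abs_mul, abs_of_nonneg (hΦ y),
            abs_of_nonneg (add_nonneg hr.le dist_nonneg)]
      _ ≤ dist x x' * (2 * m + 2 * m) + dist x x' * (2 * m) := by
          have := hΦ y
          have := lip x x'
          gcongr <;> linarith
      _ = 6 * dist x x' * m := by ring
  have hinv := abs_inv_pow_sub_inv_pow_le n hm hma hmb hab
  have hvec : (a ^ (n + 1))⁻¹ • (x - y) - (b ^ (n + 1))⁻¹ • (x' - y) =
      (a ^ (n + 1))⁻¹ • (x - x') + ((a ^ (n + 1))⁻¹ - (b ^ (n + 1))⁻¹) • (x' - y) := by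
    module
  have ha0 : 0 < a := hm.trans_le hma
  rw [hvec]
  calc ‖(a ^ (n + 1))⁻¹ • (x - x') + ((a ^ (n + 1))⁻¹ - (b ^ (n + 1))⁻¹) • (x' - y)‖
      ≤ (a ^ (n + 1))⁻¹ * dist x x' +
          |(a ^ (n + 1))⁻¹ - (b ^ (n + 1))⁻¹| * dist x' y := by
        refine (norm_add_le _ _).trans_eq ?_
        rw [norm_smul, norm_smul, Real.norm_eq_abs, Real.norm_eq_abs,
          abs_of_pos (inv_pos.mpr (pow_pos ha0 _)), dist_eq_norm, dist_eq_norm]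
    _ ≤ (dist x y ^ (n + 1))⁻¹ * dist x x' +
          3 * (n + 1) * dist x x' * (m ^ (n + 2))⁻¹ * (2 * m) := by
        gcongr
        linarith
    _ = (dist x y ^ (n + 1))⁻¹ * dist x x' + 6 * (n + 1) * dist x x' * (m ^ (n + 1))⁻¹ := by
        field_simp
        ring
    _ ≤ (dist x y ^ (n + 1))⁻¹ * dist x x' +
          6 * (n + 1) * dist x x' * ((dist x y / 2) ^ (n + 1))⁻¹ := by
        gcongr
    _ = (1 + 6 * (n + 1) * 2 ^ (n + 1)) * dist x x' / dist x y ^ (n + 1) := by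
        rw [div_pow, inv_div]
        ring

/-- Hölder (Calderón–Zygmund) regularity estimates for the suppressed
Riesz kernel `K_Φ`, in both variables. -/
theorem suppressed_kernel_hoelder
    (n : ℕ) (hn : 1 ≤ n) :
    ∃ C : ℝ, 0 < C ∧
      ∀ Φ : EuclideanSpace ℝ (Fin (n + 1)) → ℝ,
        LipschitzWith 1 Φ → (∀ x, 0 ≤ Φ x) →
        (∀ x x' y : EuclideanSpace ℝ (Fin (n + 1)), x ≠ y → 2 * dist x x' ≤ dist x y →
          ‖suppKernel n Φ x y - suppKernel n Φ x' y‖ ≤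
            C * dist x x' / dist x y ^ (n + 1)) ∧
        (∀ x y y' : EuclideanSpace ℝ (Fin (n + 1)), x ≠ y → 2 * dist y y' ≤ dist x y →
          ‖suppKernel n Φ x y - suppKernel n Φ x y'‖ ≤
            C * dist y y' / dist x y ^ (n + 1)) := by
  refine ⟨1 + 6 * (n + 1) * 2 ^ (n + 1), by positivity, fun Φ hL hΦ =>
    ⟨fun x x' y hxy h => suppKernel_sub_left_le n hL hΦ hxy h, fun x y y' hxy h => ?_⟩⟩
  rw [suppKernel_antisymm n Φ x y, suppKernel_antisymm n Φ x y', ← neg_sub', norm_neg,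
    dist_comm x y]
  exact suppKernel_sub_left_le n hL hΦ hxy.symm (by rwa [dist_comm y x])
end
end

section
/- Let n ≥ 2 and let μ be a Borel measure on ℝ^{n+1} with μ(B(x,t)) ≤ C₀ tⁿ for all x, t > 0 and with μ(B(y₀,r)) ≥ c₁ rⁿ for some y₀ ∈ ℝ^{n+1} and r > 0. Define g(x) = ∫_{B(y₀,r)} 1/(r |x−y|^{n−1}) dμ(y). Let e ∈ ℝ^{n+1} be a unit vector, set p = y₀ + 10 r e and V = B(p, r). Then there is a constant c > 0 depending only on n, C₀ and c₁ such that the directional derivative of g in the direction e satisfies −∂_e g(x) ≥ c/r for every x ∈ V; in particular |∇g(x)| ≥ c/r on V. -/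
open Metric MeasureTheory Set Filter
open scoped ENNReal NNReal Topology

noncomputable section

section NewtonKernel

variable {E : Type*} [NormedAddCommGroup E] [InnerProductSpace ℝ E]

/-- The derivative in `x` of the kernel `(r * dist x y ^ m)⁻¹`. -/
def newtonKernelDeriv (m : ℕ) (r : ℝ) (x y : E) : E →L[ℝ] ℝ :=
  (-(m / (r * ‖x - y‖ ^ (m + 2)))) • innerSL ℝ (x - y)

theorem hasFDerivAt_newtonKernel (m : ℕ) {r : ℝ} (hr : 0 < r) {x y : E} (hxy : x ≠ y) :
    HasFDerivAt (fun z => (r * dist z y ^ m)⁻¹) (newtonKernelDeriv m r x y) x := by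
  have hd : 0 < ‖x - y‖ := norm_pos_iff.2 (sub_ne_zero.2 hxy)
  have h1 := ((hasFDerivAt_id (𝕜 := ℝ) x).sub_const y).norm_sq
  have h2 := h1.sqrt (pow_pos hd 2).ne'
  simp only [id, Real.sqrt_sq (norm_nonneg _)] at h2
  have hf : HasDerivAt (fun t : ℝ => (r * t ^ m)⁻¹)
      (-(r * (m * ‖x - y‖ ^ (m - 1))) / (r * ‖x - y‖ ^ m) ^ 2) ‖x - y‖ :=
    ((hasDerivAt_pow m ‖x - y‖).const_mul r).fun_inv (by positivity)
  have h3 := hf.comp_hasFDerivAt x h2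
  simp only [dist_eq_norm]
  refine h3.congr_fderiv ?_
  ext v
  rcases m with _ | m
  · simp [newtonKernelDeriv]
  simp [newtonKernelDeriv]
  field_simp
  ring

theorem norm_newtonKernelDeriv_le (m : ℕ) {r : ℝ} (hr : 0 < r) {x y : E} (hxy : r ≤ ‖x - y‖) :
    ‖newtonKernelDeriv m r x y‖ ≤ m / (r * r ^ (m + 1)) := by
  have hd : 0 < ‖x - y‖ := hr.trans_le hxy
  rw [newtonKernelDeriv, norm_smul, innerSL_apply_norm, norm_neg,
    Real.norm_of_nonneg (by positivity)]
  calc (m : ℝ) / (r * ‖x - y‖ ^ (m + 2)) * ‖x - y‖ = m / (r * ‖x - y‖ ^ (m + 1)) := by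
        field_simp
        ring
    _ ≤ _ := by gcongr

theorem continuousOn_newtonKernelDeriv (m : ℕ) {r : ℝ} (hr : 0 < r) (x : E) :
    ContinuousOn (newtonKernelDeriv m r x) {x}ᶜ := by
  have h : ∀ y ∈ ({x}ᶜ : Set E), r * ‖x - y‖ ^ (m + 2) ≠ 0 := fun y hy =>
    mul_ne_zero hr.ne' (pow_ne_zero _ (norm_ne_zero_iff.2 (sub_ne_zero.2 (Ne.symm hy))))
  unfold newtonKernelDeriv
  fun_prop (disch := assumption)

theorem continuousOn_newtonKernel {X : Type*} [MetricSpace X] (m : ℕ) {r : ℝ} (hr : 0 < r)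
    (x : X) : ContinuousOn (fun y => (r * dist x y ^ m)⁻¹) {x}ᶜ := by
  have h : ∀ y ∈ ({x}ᶜ : Set X), r * dist x y ^ m ≠ 0 := fun y hy =>
    mul_ne_zero hr.ne' (pow_ne_zero _ (dist_ne_zero.2 (Ne.symm hy)))
  fun_prop (disch := assumption)

theorem norm_sub_bounds {r : ℝ} {y₀ e x y : E} (he : ‖e‖ = 1) (hr : 0 < r)
    (hx : x ∈ ball (y₀ + (10 * r) • e) r) (hy : y ∈ ball y₀ r) :
    ‖x - y‖ ≤ 12 * r ∧ 8 * r ≤ inner ℝ (x - y) e := by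
  rw [mem_ball_iff_norm] at hx hy
  have hsum : x - y = (x - (y₀ + (10 * r) • e)) - (y - y₀) + (10 * r) • e := by abel
  have hw : ‖(x - (y₀ + (10 * r) • e)) - (y - y₀)‖ ≤ 2 * r :=
    (norm_sub_le _ _).trans (by linarith)
  rw [hsum]
  generalize (x - (y₀ + (10 * r) • e)) - (y - y₀) = w at hw
  constructor
  · refine (norm_add_le _ _).trans ?_
    rw [norm_smul, he, Real.norm_of_nonneg (by positivity)]
    linarith
  · have h := neg_le_of_abs_le (abs_real_inner_le_norm w e)
    rw [he, mul_one] at h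
    rw [inner_add_left, real_inner_smul_left, real_inner_self_eq_norm_sq, he]
    linarith

theorem le_norm_sub_of_mem_ball {r : ℝ} {y₀ e x y : E} (he : ‖e‖ = 1) (hr : 0 < r)
    (hx : x ∈ ball (y₀ + (10 * r) • e) r) (hy : y ∈ ball y₀ r) : r ≤ ‖x - y‖ := by
  have h := (norm_sub_bounds he hr hx hy).2.trans (real_inner_le_norm _ _)
  rw [he, mul_one] at h
  linarith

theorem newtonKernelDeriv_apply_le (m : ℕ) {r : ℝ} {y₀ e x y : E} (he : ‖e‖ = 1) (hr : 0 < r)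
    (hx : x ∈ ball (y₀ + (10 * r) • e) r) (hy : y ∈ ball y₀ r) :
    newtonKernelDeriv m r x y e ≤ -(8 * m / (12 * r) ^ (m + 2)) := by
  obtain ⟨hle, hinner⟩ := norm_sub_bounds he hr hx hy
  have hd : 0 < ‖x - y‖ := hr.trans_le (le_norm_sub_of_mem_ball he hr hx hy)
  simp only [newtonKernelDeriv, smul_apply, innerSL_apply_apply, smul_eq_mul,
    neg_mul, neg_le_neg_iff]
  calc 8 * (m : ℝ) / (12 * r) ^ (m + 2) = m / (r * (12 * r) ^ (m + 2)) * (8 * r) := by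
        field_simp
    _ ≤ m / (r * ‖x - y‖ ^ (m + 2)) * inner ℝ (x - y) e := by gcongr

theorem integrableOn_newtonKernelDeriv [MeasurableSpace E] [BorelSpace E]
    [SecondCountableTopology E] (m : ℕ) {μ : Measure E} {r : ℝ} {y₀ e x : E} (he : ‖e‖ = 1)
    (hr : 0 < r) (hμ : μ (ball y₀ r) ≠ ∞) (hx : x ∈ ball (y₀ + (10 * r) • e) r) :
    IntegrableOn (newtonKernelDeriv m r x) (ball y₀ r) μ := by
  have hne : ball y₀ r ⊆ {x}ᶜ := by
    rintro y hy rfl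
    simpa [hr.not_ge] using le_norm_sub_of_mem_ball he hr hx hy
  exact IntegrableOn.of_bound hμ.lt_top
    (((continuousOn_newtonKernelDeriv m hr x).mono hne).aestronglyMeasurable measurableSet_ball) _
    ((ae_restrict_mem measurableSet_ball).mono fun y hy =>
      norm_newtonKernelDeriv_le m hr (le_norm_sub_of_mem_ball he hr hx hy))

theorem hasFDerivAt_integral_newtonKernel [MeasurableSpace E] [BorelSpace E]
    [SecondCountableTopology E] (m : ℕ) {μ : Measure E} {r : ℝ} {y₀ e x : E} (he : ‖e‖ = 1)
    (hr : 0 < r) (hμ : μ (ball y₀ r) ≠ ∞) (hx : x ∈ ball (y₀ + (10 * r) • e) r) :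
    HasFDerivAt (fun x => ∫ y in ball y₀ r, (r * dist x y ^ m)⁻¹ ∂μ)
      (∫ y in ball y₀ r, newtonKernelDeriv m r x y ∂μ) x := by
  have hne : ∀ z ∈ ball (y₀ + (10 * r) • e) r, ball y₀ r ⊆ {z}ᶜ := by
    rintro z hz y hy rfl
    simpa [hr.not_ge] using le_norm_sub_of_mem_ball he hr hz hy
  have hmeas : ∀ z ∈ ball (y₀ + (10 * r) • e) r,
      AEStronglyMeasurable (fun y => (r * dist z y ^ m)⁻¹) (μ.restrict (ball y₀ r)) :=
    fun z hz => ((continuousOn_newtonKernel m hr z).mono (hne z hz)).aestronglyMeasurable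
      measurableSet_ball
  have hmem := ae_restrict_mem (μ := μ) (measurableSet_ball (x := y₀) (ε := r))
  refine hasFDerivAt_integral_of_dominated_of_fderiv_le
    (bound := fun _ => m / (r * r ^ (m + 1))) (isOpen_ball.mem_nhds hx)
    (Filter.eventually_of_mem (isOpen_ball.mem_nhds hx) hmeas) ?_
    (integrableOn_newtonKernelDeriv m he hr hμ hx).aestronglyMeasurable
    (hmem.mono fun y hy z hz =>
      norm_newtonKernelDeriv_le m hr (le_norm_sub_of_mem_ball he hr hz hy))
    (integrableOn_const hμ)
    (hmem.mono fun y hy z hz => hasFDerivAt_newtonKernel m hr (Ne.symm (hne z hz hy)))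
  refine IntegrableOn.of_bound hμ.lt_top (hmeas x hx) (r * r ^ m)⁻¹ (hmem.mono fun y hy => ?_)
  have h := le_norm_sub_of_mem_ball he hr hx hy
  rw [← dist_eq_norm] at h
  rw [Real.norm_of_nonneg (by positivity)]
  gcongr

theorem integral_newtonKernelDeriv_apply_le [MeasurableSpace E] [BorelSpace E]
    [SecondCountableTopology E] [CompleteSpace E] (m : ℕ) {μ : Measure E} {r : ℝ} {y₀ e x : E}
    (he : ‖e‖ = 1) (hr : 0 < r) (hμ : μ (ball y₀ r) ≠ ∞)
    (hx : x ∈ ball (y₀ + (10 * r) • e) r) :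
    (∫ y in ball y₀ r, newtonKernelDeriv m r x y ∂μ) e ≤
      -(8 * m / (12 * r) ^ (m + 2)) * μ.real (ball y₀ r) := by
  have hint := integrableOn_newtonKernelDeriv m he hr hμ hx
  rw [ContinuousLinearMap.integral_apply hint, mul_comm, ← smul_eq_mul, ← setIntegral_const]
  exact setIntegral_mono_on (hint.apply_continuousLinearMap e) (integrableOn_const hμ)
    measurableSet_ball fun y hy => newtonKernelDeriv_apply_le m he hr hx hy

theorem fderiv_apply_neg_le_norm_gradient [CompleteSpace E] (f : E → ℝ) (x : E) {e : E}
    (he : ‖e‖ = 1) : -fderiv ℝ f x e ≤ ‖gradient f x‖ := by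
  rw [gradient, LinearIsometryEquiv.norm_map]
  have h := (fderiv ℝ f x).le_opNorm e
  rw [he, mul_one] at h
  exact (neg_le_abs _).trans h

end NewtonKernel

/-- gradient lower bound for the normalized Newtonian-type potential on
the ball `V = B(y₀ + 10 r e, r)`, `n ≥ 2`. -/
theorem newton_potential_gradient_lower
    (n : ℕ) (hn : 2 ≤ n) (C₀ c₁ : ℝ) (hC₀ : 0 < C₀) (hc₁ : 0 < c₁) :
    ∃ c : ℝ, 0 < c ∧
      ∀ μ : Measure (EuclideanSpace ℝ (Fin (n + 1))),
        (∀ (x : EuclideanSpace ℝ (Fin (n + 1))) (t : ℝ), 0 < t →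
          μ (ball x t) ≤ ENNReal.ofReal (C₀ * t ^ n)) →
        ∀ (y₀ : EuclideanSpace ℝ (Fin (n + 1))) (r : ℝ), 0 < r →
          ENNReal.ofReal (c₁ * r ^ n) ≤ μ (ball y₀ r) →
          ∀ e : EuclideanSpace ℝ (Fin (n + 1)), ‖e‖ = 1 →
            ∀ x ∈ ball (y₀ + (10 * r) • e) r,
              c / r ≤ -fderiv ℝ (newtonPot n μ y₀ r) x e ∧
              c / r ≤ ‖gradient (newtonPot n μ y₀ r) x‖ := by
  obtain ⟨m, rfl⟩ : ∃ m, n = m + 1 := ⟨n - 1, by omega⟩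
  have hm : (0 : ℝ) < m := by exact_mod_cast (by omega : 0 < m)
  refine ⟨8 * m * c₁ / 12 ^ (m + 2), by positivity, ?_⟩
  intro μ hμ y₀ r hr hlow e he x hx
  have hfin : μ (ball y₀ r) ≠ ∞ := ne_top_of_le_ne_top ENNReal.ofReal_ne_top (hμ y₀ r hr)
  have hderiv : fderiv ℝ (newtonPot (m + 1) μ y₀ r) x =
      ∫ y in ball y₀ r, newtonKernelDeriv m r x y ∂μ :=
    (hasFDerivAt_integral_newtonKernel m he hr hfin hx).fderiv
  have hreal : c₁ * r ^ (m + 1) ≤ μ.real (ball y₀ r) :=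
    (ENNReal.ofReal_le_iff_le_toReal hfin).1 hlow
  have key : 8 * m * c₁ / 12 ^ (m + 2) / r ≤ -fderiv ℝ (newtonPot (m + 1) μ y₀ r) x e := by
    rw [hderiv]
    have h := integral_newtonKernelDeriv_apply_le m he hr hfin hx
    calc 8 * m * c₁ / 12 ^ (m + 2) / r
        = 8 * m / (12 * r) ^ (m + 2) * (c₁ * r ^ (m + 1)) := by
          rw [mul_pow]
          field_simp
          ring
      _ ≤ 8 * m / (12 * r) ^ (m + 2) * μ.real (ball y₀ r) := by gcongr
      _ ≤ _ := by linarith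
  exact ⟨key, key.trans (fderiv_apply_neg_le_norm_gradient _ x he)⟩
end
end

section
/- Let μ be a 1-AD-regular measure on ℝ² with AD-regularity constant c₀. Let y₁, y₂ ∈ supp μ and ℓ > 0 satisfy 3ℓ ≤ |y₁ − y₂| ≤ 4c₀²ℓ, let 0 < r ≤ ℓ, and set B₁ = B(y₁,r), B₂ = B(y₂,r). Define g(x) = ∫_{B₁} (1/r) log(1/|x−y|) dμ(y) − (μ(B₁)/μ(B₂)) ∫_{B₂} (1/r) log(1/|x−y|) dμ(y). Then: (i) g is continuous on ℝ² and g(x) → 0 as |x| → ∞; (ii) g(x) > 0 for every x such that |x−y| < ℓ for all y ∈ B₁ and |x−y| > ℓ for all y ∈ B₂; (iii) ‖g‖_∞ ≤ C (1 + log(ℓ/r)), where C depends only on c₀. -/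
open Metric MeasureTheory Set Filter
open scoped ENNReal NNReal Topology

noncomputable section

theorem ae_mem_measSupport {d : ℕ} (μ : Measure (EuclideanSpace ℝ (Fin d))) :
    ∀ᵐ y ∂μ, y ∈ measSupport μ := by
  refine measure_null_of_locally_null _ fun x hx => ?_
  simp only [measSupport, mem_compl_iff, mem_setOf_eq, not_forall, not_lt] at hx
  obtain ⟨s, hs, hs0⟩ := hx
  exact ⟨ball x s, mem_nhdsWithin_of_mem_nhds (ball_mem_nhds x hs), nonpos_iff_eq_zero.1 hs0⟩

/-- An AD-regular measure, restricted to a ball centred on its support of radius at most half the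
diameter of the support, has linear growth at all points of space and at all scales. -/
theorem ADRegularMeasureWith.restrict_ball_le {d : ℕ} {c₀ : ℝ} (hc₀ : 0 < c₀)
    {μ : Measure (EuclideanSpace ℝ (Fin d))} (hμ : ADRegularMeasureWith c₀ 1 μ)
    {z : EuclideanSpace ℝ (Fin d)} (hz : z ∈ measSupport μ) {r : ℝ} (hr : 0 < r)
    (hd : ENNReal.ofReal (2 * r) ≤ ediam (measSupport μ))
    (x : EuclideanSpace ℝ (Fin d)) {s : ℝ} (hs : 0 < s) :
    μ.restrict (ball z r) (ball x s) ≤ ENNReal.ofReal (2 * c₀ * s) := by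
  have hrd : ENNReal.ofReal r ≤ ediam (measSupport μ) :=
    (ENNReal.ofReal_le_ofReal (by linarith)).trans hd
  by_cases hsd : s ≤ r
  · by_cases hne : ∃ p ∈ ball x s, p ∈ measSupport μ
    · obtain ⟨p, hpx, hp⟩ := hne
      calc μ.restrict (ball z r) (ball x s) ≤ μ (ball x s) := Measure.restrict_apply_le _ _
        _ ≤ μ (ball p (2 * s)) := by
          refine measure_mono (ball_subset_ball' ?_)
          rw [mem_ball, dist_comm] at hpx
          linarith
        _ ≤ ENNReal.ofReal (c₀ * (2 * s) ^ 1) :=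
          (hμ p hp (2 * s) (by linarith)
            ((ENNReal.ofReal_le_ofReal (by linarith)).trans hd)).2
        _ = ENNReal.ofReal (2 * c₀ * s) := by congr 1; ring
    · have h0 : μ (ball x s) = 0 :=
        measure_mono_null (fun p hp hps => hne ⟨p, hp, hps⟩) (ae_mem_measSupport μ)
      exact (Measure.restrict_apply_le _ _).trans (by simp [h0])
  · calc μ.restrict (ball z r) (ball x s) ≤ μ.restrict (ball z r) univ :=
          measure_mono (subset_univ _)
      _ = μ (ball z r) := Measure.restrict_apply_univ _
      _ ≤ ENNReal.ofReal (c₀ * r ^ 1) := (hμ z hz r hr hrd).2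
      _ ≤ ENNReal.ofReal (2 * c₀ * s) := by
        refine ENNReal.ofReal_le_ofReal ?_
        nlinarith

theorem log_one_div_sub_log_one_div_le {a b δ e : ℝ} (ha : 0 < a) (hb : 0 < b) (hδ : 0 < δ)
    (hab : |a - b| ≤ e) :
    Real.log (1 / a) - Real.log (1 / b) ≤ Real.posLog (δ / a) + e / δ := by
  have hba : b - a ≤ e := by linarith [(abs_le.1 hab).1]
  have he : 0 ≤ e := (abs_nonneg _).trans hab
  rw [one_div, one_div, Real.log_inv, Real.log_inv]
  rcases le_or_gt δ a with h | h
  · have h1 : Real.log (b / a) ≤ b / a - 1 := Real.log_le_sub_one_of_pos (by positivity)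
    have h2 : b / a - 1 ≤ e / δ := by
      calc b / a - 1 = (b - a) / a := by field_simp
        _ ≤ e / a := by gcongr
        _ ≤ e / δ := by gcongr
    rw [Real.log_div hb.ne' ha.ne'] at h1
    linarith [Real.posLog_nonneg (x := δ / a)]
  · have h1 : Real.log (b / δ) ≤ b / δ - 1 := Real.log_le_sub_one_of_pos (by positivity)
    have h2 : b / δ - 1 ≤ e / δ := by
      calc b / δ - 1 = (b - δ) / δ := by field_simp
        _ ≤ e / δ := by gcongr; linarith
    have h3 : Real.log (δ / a) ≤ Real.posLog (δ / a) := le_max_right _ _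
    rw [Real.log_div hb.ne' hδ.ne'] at h1
    rw [Real.log_div hδ.ne' ha.ne'] at h3
    linarith

theorem abs_log_div_le {R d ℓ r B : ℝ} (hd : 0 < d) (hR : 0 < R) (hr : 0 < r) (hrℓ : r ≤ ℓ)
    (hB : 1 ≤ B) (hdR : d ≤ B * R) (hRd : R ≤ B * max d ℓ) :
    |Real.log (R / d)| ≤ Real.log B + Real.log (ℓ / r) + Real.posLog (r / d) := by
  have hB0 : 0 < B := by linarith
  have hℓ : 0 < ℓ := hr.trans_le hrℓ
  have h1 : 0 ≤ Real.log (ℓ / r) := Real.log_nonneg ((one_le_div hr).2 hrℓ)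
  have h2 : 0 ≤ Real.posLog (r / d) := Real.posLog_nonneg
  have h3 : Real.log (r / d) ≤ Real.posLog (r / d) := le_max_right _ _
  have h4 : Real.log d ≤ Real.log B + Real.log R := by
    rw [← Real.log_mul hB0.ne' hR.ne']
    exact Real.log_le_log hd hdR
  have h5 : Real.log R ≤ Real.log B + Real.log (max d ℓ) := by
    rw [← Real.log_mul hB0.ne' (lt_max_of_lt_left hd).ne']
    exact Real.log_le_log hR hRd
  rw [abs_le, Real.log_div hR.ne' hd.ne']
  refine ⟨by linarith, ?_⟩
  rcases le_total d ℓ with h | h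
  · rw [max_eq_right h] at h5
    rw [Real.log_div hr.ne' hd.ne'] at h3
    rw [Real.log_div hℓ.ne' hr.ne']
    linarith
  · rw [max_eq_left h] at h5
    linarith

theorem abs_log_div_le_of_abs_sub_le {D d M : ℝ} (hMD : M < D) (h : |D - d| ≤ M) :
    |Real.log (D / d)| ≤ M / (D - M) := by
  have hM : 0 ≤ M := (abs_nonneg _).trans h
  have hD : 0 < D := hM.trans_lt hMD
  have hDM : 0 < D - M := sub_pos.2 hMD
  obtain ⟨h1, h2⟩ := abs_le.1 h
  have hd : 0 < d := by linarith
  have h3 : Real.log (D / d) ≤ D / d - 1 := Real.log_le_sub_one_of_pos (by positivity)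
  have h4 : Real.log (d / D) ≤ d / D - 1 := Real.log_le_sub_one_of_pos (by positivity)
  have h5 : D / d - 1 ≤ M / (D - M) := by
    calc D / d - 1 = (D - d) / d := by field_simp
      _ ≤ M / d := by gcongr
      _ ≤ M / (D - M) := by gcongr; linarith
  have h6 : d / D - 1 ≤ M / (D - M) := by
    calc d / D - 1 = (d - D) / D := by field_simp
      _ ≤ M / D := by gcongr; linarith
      _ ≤ M / (D - M) := by gcongr; linarith
  rw [Real.log_div hD.ne' hd.ne'] at h3 ⊢
  rw [Real.log_div hd.ne' hD.ne'] at h4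
  rw [abs_le]
  constructor <;> linarith

section LogarithmicPotential

variable {X : Type*} [MetricSpace X] [MeasurableSpace X] {ν : Measure X} {C : ℝ}

theorem ae_dist_pos_of_measure_ball_le
    (hν : ∀ x s, 0 < s → ν (ball x s) ≤ ENNReal.ofReal (C * s)) (x : X) :
    ∀ᵐ y ∂ν, 0 < dist x y := by
  have h0 : ν {x} = 0 := by
    have hlim : Tendsto (fun s : ℝ => ENNReal.ofReal (C * s)) (𝓝[>] 0) (𝓝 0) := by
      have : Continuous fun s : ℝ => ENNReal.ofReal (C * s) :=
        ENNReal.continuous_ofReal.comp (continuous_const_mul C)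
      simpa using (this.tendsto 0).mono_left nhdsWithin_le_nhds
    refine nonpos_iff_eq_zero.1 (ge_of_tendsto hlim ?_)
    filter_upwards [self_mem_nhdsWithin] with s hs
    exact (measure_mono (singleton_subset_iff.2 (mem_ball_self hs))).trans (hν x s hs)
  filter_upwards [measure_eq_zero_iff_ae_notMem.1 h0] with y hy
  exact dist_pos.2 fun h => hy h.symm

theorem log_div_dist_ae_eq (hν : ∀ x s, 0 < s → ν (ball x s) ≤ ENNReal.ofReal (C * s))
    {R : ℝ} (hR : 0 < R) (x : X) :
    (fun y => Real.log (R / dist x y)) =ᵐ[ν] fun y => Real.log R + Real.log (1 / dist x y) := by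
  filter_upwards [ae_dist_pos_of_measure_ball_le hν x] with y hd
  rw [Real.log_div hR.ne' hd.ne', one_div, Real.log_inv]
  ring

variable [OpensMeasurableSpace X]

theorem lintegral_posLog_div_dist_le (hC : 0 ≤ C)
    (hν : ∀ x s, 0 < s → ν (ball x s) ≤ ENNReal.ofReal (C * s)) (x : X) {δ : ℝ} (hδ : 0 < δ) :
    ∫⁻ y, ENNReal.ofReal (Real.posLog (δ / dist x y)) ∂ν ≤ ENNReal.ofReal (C * δ) := by
  rw [lintegral_eq_lintegral_meas_lt ν (Eventually.of_forall fun y => Real.posLog_nonneg)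
    (by fun_prop)]
  have hexp : IntegrableOn (fun t : ℝ => Real.exp (-t)) (Ioi 0) := by
    simpa using exp_neg_integrableOn_Ioi 0 one_pos
  calc ∫⁻ t in Ioi (0 : ℝ), ν {y | t < Real.posLog (δ / dist x y)}
      ≤ ∫⁻ t in Ioi (0 : ℝ), ENNReal.ofReal (C * δ * Real.exp (-t)) := by
        refine setLIntegral_mono' measurableSet_Ioi fun t ht => ?_
        rw [mul_assoc]
        refine (measure_mono fun y hy => ?_).trans (hν x (δ * Real.exp (-t)) (by positivity))
        have hlog : t < Real.log (δ / dist x y) := by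
          rcases lt_max_iff.1 (show t < max 0 (Real.log (δ / dist x y)) from hy) with h | h
          · exact absurd h (not_lt.2 (le_of_lt ht))
          · exact h
        have hd : 0 < dist x y := by
          refine lt_of_le_of_ne dist_nonneg fun h => ?_
          rw [← h, div_zero, Real.log_zero] at hlog
          exact lt_asymm hlog ht
        have := (Real.lt_log_iff_exp_lt (by positivity)).1 hlog
        rw [mem_ball, dist_comm, Real.exp_neg, ← div_eq_mul_inv, lt_div_iff₀ (Real.exp_pos t)]
        rw [lt_div_iff₀ hd] at this
        linarith
    _ = ENNReal.ofReal (∫ t in Ioi (0 : ℝ), C * δ * Real.exp (-t)) := by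
        rw [ofReal_integral_eq_lintegral_ofReal (hexp.const_mul _)
          (Eventually.of_forall fun t => by positivity)]
    _ = ENNReal.ofReal (C * δ) := by
        rw [integral_const_mul, integral_exp_neg_Ioi_zero, mul_one]

theorem integrable_posLog_div_dist (hC : 0 ≤ C)
    (hν : ∀ x s, 0 < s → ν (ball x s) ≤ ENNReal.ofReal (C * s)) (x : X) {δ : ℝ} (hδ : 0 < δ) :
    Integrable (fun y => Real.posLog (δ / dist x y)) ν := by
  have hm : Measurable fun y => Real.posLog (δ / dist x y) := by fun_prop
  exact (lintegral_ofReal_ne_top_iff_integrable hm.aestronglyMeasurable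
    (Eventually.of_forall fun y => Real.posLog_nonneg)).1
    ((lintegral_posLog_div_dist_le hC hν x hδ).trans_lt ENNReal.ofReal_lt_top).ne

theorem integral_posLog_div_dist_le (hC : 0 ≤ C)
    (hν : ∀ x s, 0 < s → ν (ball x s) ≤ ENNReal.ofReal (C * s)) (x : X) {δ : ℝ} (hδ : 0 < δ) :
    ∫ y, Real.posLog (δ / dist x y) ∂ν ≤ C * δ := by
  have hm : Measurable fun y => Real.posLog (δ / dist x y) := by fun_prop
  rw [integral_eq_lintegral_of_nonneg_ae (Eventually.of_forall fun y => Real.posLog_nonneg)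
    hm.aestronglyMeasurable]
  exact ENNReal.toReal_le_of_le_ofReal (by positivity) (lintegral_posLog_div_dist_le hC hν x hδ)

variable [IsFiniteMeasure ν] {z : X} {r : ℝ}

theorem integrable_log_one_div_dist (hC : 0 ≤ C)
    (hν : ∀ x s, 0 < s → ν (ball x s) ≤ ENNReal.ofReal (C * s)) (hz : ∀ᵐ y ∂ν, y ∈ ball z r)
    (hr : 0 < r) (x : X) : Integrable (fun y => Real.log (1 / dist x y)) ν := by
  have hM : 0 < dist x z + r := by positivity
  refine ((integrable_posLog_div_dist hC hν x hM).sub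
    (integrable_const (Real.log (dist x z + r)))).congr ?_
  filter_upwards [hz, ae_dist_pos_of_measure_ball_le hν x] with y hy hd
  have hle : dist x y ≤ dist x z + r := by
    rw [mem_ball'] at hy
    linarith [dist_triangle x z y]
  have h1 : 1 ≤ |(dist x z + r) / dist x y| := by
    rw [abs_of_pos (by positivity), le_div_iff₀ hd]
    linarith
  simp only [Pi.sub_apply]
  rw [Real.posLog_eq_log h1, Real.log_div hM.ne' hd.ne', one_div, Real.log_inv]
  ring

theorem integrable_log_div_dist (hC : 0 ≤ C)
    (hν : ∀ x s, 0 < s → ν (ball x s) ≤ ENNReal.ofReal (C * s)) (hz : ∀ᵐ y ∂ν, y ∈ ball z r)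
    (hr : 0 < r) {R : ℝ} (hR : 0 < R) (x : X) :
    Integrable (fun y => Real.log (R / dist x y)) ν :=
  ((integrable_const _).add (integrable_log_one_div_dist hC hν hz hr x)).congr
    (log_div_dist_ae_eq hν hR x).symm

theorem integral_log_div_dist (hC : 0 ≤ C)
    (hν : ∀ x s, 0 < s → ν (ball x s) ≤ ENNReal.ofReal (C * s)) (hz : ∀ᵐ y ∂ν, y ∈ ball z r)
    (hr : 0 < r) {R : ℝ} (hR : 0 < R) (x : X) :
    ∫ y, Real.log (R / dist x y) ∂ν =
      ν.real univ * Real.log R + ∫ y, Real.log (1 / dist x y) ∂ν := by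
  rw [integral_congr_ae (log_div_dist_ae_eq hν hR x),
    integral_add (integrable_const _) (integrable_log_one_div_dist hC hν hz hr x)]
  simp

theorem continuous_integral_log_one_div_dist (hC : 0 ≤ C)
    (hν : ∀ x s, 0 < s → ν (ball x s) ≤ ENNReal.ofReal (C * s)) (hz : ∀ᵐ y ∂ν, y ∈ ball z r)
    (hr : 0 < r) : Continuous fun x => ∫ y, Real.log (1 / dist x y) ∂ν := by
  have key : ∀ x x' : X, ∀ δ > 0, (∫ y, Real.log (1 / dist x y) ∂ν) -
      ∫ y, Real.log (1 / dist x' y) ∂ν ≤ C * δ + ν.real univ * (dist x x' / δ) := by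
    intro x x' δ hδ
    have hi := integrable_posLog_div_dist hC hν x hδ
    rw [← integral_sub (integrable_log_one_div_dist hC hν hz hr x)
      (integrable_log_one_div_dist hC hν hz hr x')]
    calc ∫ y, Real.log (1 / dist x y) - Real.log (1 / dist x' y) ∂ν
        ≤ ∫ y, Real.posLog (δ / dist x y) + dist x x' / δ ∂ν := by
          refine integral_mono_ae ((integrable_log_one_div_dist hC hν hz hr x).sub
            (integrable_log_one_div_dist hC hν hz hr x')) (hi.add (integrable_const _)) ?_
          filter_upwards [ae_dist_pos_of_measure_ball_le hν x,
            ae_dist_pos_of_measure_ball_le hν x'] with y hd hd'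
          exact log_one_div_sub_log_one_div_le hd hd' hδ (abs_dist_sub_le x x' y)
      _ ≤ C * δ + ν.real univ * (dist x x' / δ) := by
          rw [integral_add hi (integrable_const _)]
          simpa using integral_posLog_div_dist_le hC hν x hδ
  rw [Metric.continuous_iff]
  intro x ε hε
  set m := ν.real univ with hm
  have hm0 : 0 ≤ m := measureReal_nonneg
  set δ := ε / (2 * (C + 1)) with hδdef
  have hδ : 0 < δ := by positivity
  have hCδ : C * δ < ε / 2 := by
    rw [hδdef, ← mul_div_assoc, div_lt_div_iff₀ (by positivity) (by positivity)]
    nlinarith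
  refine ⟨δ * (ε / 2) / (m + 1), by positivity, fun x' hx' => ?_⟩
  have hsmall : m * (dist x' x / δ) ≤ ε / 2 := by
    rw [lt_div_iff₀ (by positivity)] at hx'
    rw [← mul_div_assoc, div_le_iff₀ hδ]
    nlinarith [dist_nonneg (x := x') (y := x)]
  have h1 := key x' x δ hδ
  have h2 := key x x' δ hδ
  rw [dist_comm x x'] at h2
  rw [Real.dist_eq, abs_lt]
  constructor <;> linarith

theorem abs_integral_log_div_dist_le (hC : 0 ≤ C)
    (hν : ∀ x s, 0 < s → ν (ball x s) ≤ ENNReal.ofReal (C * s)) {R ℓ B : ℝ} (hR : 0 < R)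
    (hr : 0 < r) (hrℓ : r ≤ ℓ) (hB : 1 ≤ B) (x : X)
    (hdR : ∀ᵐ y ∂ν, dist x y ≤ B * R ∧ R ≤ B * max (dist x y) ℓ) :
    |∫ y, Real.log (R / dist x y) ∂ν| ≤
      ν.real univ * (Real.log B + Real.log (ℓ / r)) + C * r := by
  have hi := integrable_posLog_div_dist hC hν x hr
  calc |∫ y, Real.log (R / dist x y) ∂ν|
      ≤ ∫ y, Real.log B + Real.log (ℓ / r) + Real.posLog (r / dist x y) ∂ν := by
        rw [← Real.norm_eq_abs]
        refine norm_integral_le_of_norm_le ((integrable_const _).add hi) ?_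
        filter_upwards [hdR, ae_dist_pos_of_measure_ball_le hν x] with y hy hd
        exact abs_log_div_le hd hR hr hrℓ hB hy.1 hy.2
    _ ≤ ν.real univ * (Real.log B + Real.log (ℓ / r)) + C * r := by
        rw [integral_add (integrable_const _) hi]
        simpa using integral_posLog_div_dist_le hC hν x hr

end LogarithmicPotential

/-- Since `logPot` is the potential of a measure of total mass zero, the kernel may be rescaled. -/
theorem logPot_eq {μ : Measure (EuclideanSpace ℝ (Fin 2))} {y₁ y₂ : EuclideanSpace ℝ (Fin 2)}
    {r C : ℝ} (hC : 0 ≤ C) (hr : 0 < r)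
    [IsFiniteMeasure (μ.restrict (ball y₁ r))] [IsFiniteMeasure (μ.restrict (ball y₂ r))]
    (h₁ : ∀ x s, 0 < s → μ.restrict (ball y₁ r) (ball x s) ≤ ENNReal.ofReal (C * s))
    (h₂ : ∀ x s, 0 < s → μ.restrict (ball y₂ r) (ball x s) ≤ ENNReal.ofReal (C * s))
    (hpos : 0 < μ.real (ball y₂ r)) {R : ℝ} (hR : 0 < R) (x : EuclideanSpace ℝ (Fin 2)) :
    logPot μ y₁ y₂ r x = 1 / r * ((∫ y in ball y₁ r, Real.log (R / dist x y) ∂μ) -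
      μ.real (ball y₁ r) / μ.real (ball y₂ r) *
        ∫ y in ball y₂ r, Real.log (R / dist x y) ∂μ) := by
  rw [integral_log_div_dist hC h₁ (ae_restrict_mem measurableSet_ball) hr hR x,
    integral_log_div_dist hC h₂ (ae_restrict_mem measurableSet_ball) hr hR x, logPot,
    integral_const_mul, integral_const_mul]
  simp only [measureReal_restrict_apply_univ]
  change _ - μ.real (ball y₁ r) / μ.real (ball y₂ r) * _ = _
  field_simp
  ring

/-- properties of the auxiliary logarithmic potential associated with a
`1`-AD-regular measure in the plane: continuity and vanishing at infinity, positivity,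
and the bound `‖g‖_∞ ≤ C (1 + log(ℓ/r))`. -/
theorem log_potential_properties
    (c₀ : ℝ) (hc₀ : 0 < c₀) :
    ∃ C : ℝ, 0 < C ∧
      ∀ μ : Measure (EuclideanSpace ℝ (Fin 2)), ADRegularMeasureWith c₀ 1 μ →
        ∀ y₁ ∈ measSupport μ, ∀ y₂ ∈ measSupport μ, ∀ ℓ r : ℝ, 0 < ℓ →
          3 * ℓ ≤ dist y₁ y₂ → dist y₁ y₂ ≤ 4 * c₀ ^ 2 * ℓ → 0 < r → r ≤ ℓ →
          (Continuous (logPot μ y₁ y₂ r) ∧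
            Filter.Tendsto (logPot μ y₁ y₂ r)
              (Filter.cocompact (EuclideanSpace ℝ (Fin 2))) (nhds 0)) ∧
          (∀ x : EuclideanSpace ℝ (Fin 2),
            (∀ y ∈ ball y₁ r, dist x y < ℓ) → (∀ y ∈ ball y₂ r, ℓ < dist x y) →
              0 < logPot μ y₁ y₂ r x) ∧
          (∀ x, |logPot μ y₁ y₂ r x| ≤ C * (1 + Real.log (ℓ / r))) := by
  set B : ℝ := 3 + 4 * c₀ ^ 2 with hBdef
  have hB : 1 ≤ B := by nlinarith [sq_nonneg c₀]
  have hlogB : 0 ≤ Real.log B := Real.log_nonneg hB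
  refine ⟨(1 + c₀ ^ 2) * (c₀ * (Real.log B + 2)), by positivity, ?_⟩
  intro μ hμ y₁ hy₁ y₂ hy₂ ℓ r hℓ hsep hdist hr hrℓ
  have hdiam : ENNReal.ofReal (2 * r) ≤ ediam (measSupport μ) := by
    refine le_trans ?_ (Metric.edist_le_ediam_of_mem hy₁ hy₂)
    rw [edist_dist]
    exact ENNReal.ofReal_le_ofReal (by linarith)
  have hdiam' : ENNReal.ofReal r ≤ ediam (measSupport μ) :=
    (ENNReal.ofReal_le_ofReal (by linarith)).trans hdiam
  have hC : 0 ≤ 2 * c₀ := by positivity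
  have hg : ∀ z ∈ measSupport μ, ∀ x s, 0 < s →
      μ.restrict (ball z r) (ball x s) ≤ ENNReal.ofReal (2 * c₀ * s) :=
    fun z hz x s hs => hμ.restrict_ball_le hc₀ hz hr hdiam x hs
  have hfin : ∀ z ∈ measSupport μ, μ (ball z r) ≠ ∞ := fun z hz =>
    ((hμ z hz r hr hdiam').2.trans_lt ENNReal.ofReal_lt_top).ne
  have hup : ∀ z ∈ measSupport μ, μ.real (ball z r) ≤ c₀ * r := fun z hz =>
    ENNReal.toReal_le_of_le_ofReal (by positivity) (by simpa using (hμ z hz r hr hdiam').2)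
  have hlow : ∀ z ∈ measSupport μ, c₀⁻¹ * r ≤ μ.real (ball z r) := fun z hz =>
    (ENNReal.ofReal_le_iff_le_toReal (hfin z hz)).1 (by simpa using (hμ z hz r hr hdiam').1)
  have hpos : ∀ z ∈ measSupport μ, 0 < μ.real (ball z r) := fun z hz =>
    lt_of_lt_of_le (by positivity) (hlow z hz)
  have h₁ := hg y₁ hy₁
  have h₂ := hg y₂ hy₂
  have : IsFiniteMeasure (μ.restrict (ball y₁ r)) :=
    isFiniteMeasure_restrict.2 (hfin y₁ hy₁)
  have : IsFiniteMeasure (μ.restrict (ball y₂ r)) :=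
    isFiniteMeasure_restrict.2 (hfin y₂ hy₂)
  have hb₁ : ∀ᵐ y ∂μ.restrict (ball y₁ r), y ∈ ball y₁ r := ae_restrict_mem measurableSet_ball
  have hb₂ : ∀ᵐ y ∂μ.restrict (ball y₂ r), y ∈ ball y₂ r := ae_restrict_mem measurableSet_ball
  have hpot := fun {R : ℝ} (hR : 0 < R) x => logPot_eq hC hr h₁ h₂ (hpos y₂ hy₂) hR x
  set a := μ.real (ball y₁ r) / μ.real (ball y₂ r) with hadef
  have ha0 : 0 ≤ a := by positivity
  have ha : a ≤ c₀ ^ 2 := by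
    rw [hadef, div_le_iff₀ (hpos y₂ hy₂)]
    calc μ.real (ball y₁ r) ≤ c₀ * r := hup y₁ hy₁
      _ = c₀ ^ 2 * (c₀⁻¹ * r) := by field_simp
      _ ≤ c₀ ^ 2 * μ.real (ball y₂ r) := by gcongr; exact hlow y₂ hy₂
  refine ⟨⟨?_, ?_⟩, ?_, ?_⟩
  · have hcont : Continuous fun x => 1 / r * ((∫ y in ball y₁ r, Real.log (1 / dist x y) ∂μ) -
        a * ∫ y in ball y₂ r, Real.log (1 / dist x y) ∂μ) :=
      continuous_const.mul ((continuous_integral_log_one_div_dist hC h₁ hb₁ hr).sub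
        (continuous_const.mul (continuous_integral_log_one_div_dist hC h₂ hb₂ hr)))
    exact hcont.congr fun x => (hpot one_pos x).symm
  · set M := dist y₁ y₂ + r with hM
    have hlim : Tendsto (fun x => 1 / r * ((1 + a) * (c₀ * r)) * (M / (dist x y₁ - M)))
        (cocompact (EuclideanSpace ℝ (Fin 2))) (𝓝 0) := by
      have h := (tendsto_const_nhds (x := M)).div_atTop
        (tendsto_atTop_add_const_right _ (-M) (tendsto_dist_right_cocompact_atTop y₁))
      simpa [sub_eq_add_neg] using h.const_mul (1 / r * ((1 + a) * (c₀ * r)))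
    refine squeeze_zero_norm' ?_ hlim
    filter_upwards [(tendsto_dist_right_cocompact_atTop y₁).eventually_gt_atTop M] with x hx
    have hM0 : 0 ≤ M := by positivity
    have hD : 0 < dist x y₁ := hM0.trans_lt hx
    have hsub : 0 < dist x y₁ - M := sub_pos.2 hx
    have hfar : ∀ z ∈ measSupport μ, dist y₁ z ≤ dist y₁ y₂ →
        |∫ y in ball z r, Real.log (dist x y₁ / dist x y) ∂μ| ≤
          c₀ * r * (M / (dist x y₁ - M)) := by
      intro z hz hyz
      have hle := norm_setIntegral_le_of_norm_le_const (μ := μ) (s := ball z r)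
        (f := fun y => Real.log (dist x y₁ / dist x y)) (C := M / (dist x y₁ - M))
        (hfin z hz).lt_top fun y hy => by
          refine abs_log_div_le_of_abs_sub_le hx ?_
          rw [mem_ball'] at hy
          have := abs_dist_sub_le y₁ y x
          rw [dist_comm y₁ x, dist_comm y x] at this
          linarith [dist_triangle y₁ z y]
      rw [mul_comm] at hle
      exact hle.trans (mul_le_mul_of_nonneg_right (hup z hz) (by positivity))
    have e₁ := hfar y₁ hy₁ (by simp)
    have e₂ := hfar y₂ hy₂ le_rfl
    rw [hpot hD x, Real.norm_eq_abs, abs_mul, abs_of_pos (by positivity : 0 < 1 / r), mul_assoc]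
    gcongr
    refine (abs_sub _ _).trans ?_
    rw [abs_mul, abs_of_nonneg ha0]
    nlinarith [mul_le_mul_of_nonneg_left e₂ ha0]
  · intro x hx₁ hx₂
    rw [hpot hℓ x]
    have p₁ : 0 < ∫ y in ball y₁ r, Real.log (ℓ / dist x y) ∂μ := by
      have hlog : ∀ᵐ y ∂μ.restrict (ball y₁ r), 0 < Real.log (ℓ / dist x y) := by
        filter_upwards [hb₁, ae_dist_pos_of_measure_ball_le h₁ x] with y hy hd
        exact Real.log_pos ((one_lt_div hd).2 (hx₁ y hy))
      refine (integral_pos_iff_support_of_nonneg_ae (hlog.mono fun y hy => hy.le)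
        (integrable_log_div_dist hC h₁ hb₁ hr hℓ x)).2 (pos_iff_ne_zero.2 fun h0 => ?_)
      have hne : μ.restrict (ball y₁ r) ≠ 0 := by
        rw [Ne, Measure.restrict_eq_zero]
        exact (hy₁ r hr).ne'
      have : (ae (μ.restrict (ball y₁ r))).NeBot := ae_neBot.2 hne
      obtain ⟨y, hy, hy'⟩ := (hlog.and (measure_eq_zero_iff_ae_notMem.1 h0)).exists
      exact hy' hy.ne'
    have p₂ : ∫ y in ball y₂ r, Real.log (ℓ / dist x y) ∂μ ≤ 0 := by
      refine integral_nonpos_of_ae ?_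
      filter_upwards [hb₂] with y hy
      exact Real.log_nonpos (by positivity) (div_le_one_of_le₀ (hx₂ y hy).le dist_nonneg)
    have := mul_nonneg ha0 (neg_nonneg.2 p₂)
    exact mul_pos (by positivity) (by linarith)
  · intro x
    set R := ℓ + dist x y₁ with hRdef
    have hR : 0 < R := by positivity
    have hL : 0 ≤ Real.log (ℓ / r) := Real.log_nonneg ((one_le_div hr).2 hrℓ)
    have hbd : ∀ z ∈ measSupport μ, dist y₁ z ≤ 4 * c₀ ^ 2 * ℓ →
        |∫ y in ball z r, Real.log (R / dist x y) ∂μ| ≤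
          c₀ * r * (Real.log B + 2 + Real.log (ℓ / r)) := by
      intro z hz hyz
      have : IsFiniteMeasure (μ.restrict (ball z r)) := isFiniteMeasure_restrict.2 (hfin z hz)
      refine (abs_integral_log_div_dist_le hC (hg z hz) hR hr hrℓ hB x ?_).trans ?_
      · filter_upwards [ae_restrict_mem measurableSet_ball] with y hy
        rw [mem_ball'] at hy
        have hc : 0 ≤ c₀ ^ 2 := sq_nonneg c₀
        have t₁ : dist x y ≤ dist x y₁ + 4 * c₀ ^ 2 * ℓ + ℓ := by
          linarith [dist_triangle x y₁ y, dist_triangle y₁ z y]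
        have t₂ : dist x y₁ ≤ dist x y + 4 * c₀ ^ 2 * ℓ + ℓ := by
          linarith [dist_triangle x y y₁, dist_triangle y₁ z y, dist_comm y y₁]
        have m₁ := le_max_left (dist x y) ℓ
        have m₂ := le_max_right (dist x y) ℓ
        constructor
        · nlinarith [mul_nonneg hc (dist_nonneg (x := x) (y := y₁)),
            dist_nonneg (x := x) (y := y₁)]
        · nlinarith [mul_le_mul_of_nonneg_left m₂ hc]
      · rw [measureReal_restrict_apply_univ]
        nlinarith [mul_le_mul_of_nonneg_right (hup z hz) (add_nonneg hlogB hL)]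
    have e₁ := hbd y₁ hy₁ (by rw [dist_self]; positivity)
    have e₂ := hbd y₂ hy₂ hdist
    have hT : 0 ≤ c₀ * r * (Real.log B + 2 + Real.log (ℓ / r)) := by positivity
    rw [hpot hR x, abs_mul, abs_of_pos (by positivity : 0 < 1 / r)]
    calc _ ≤ 1 / r * ((1 + c₀ ^ 2) * (c₀ * r * (Real.log B + 2 + Real.log (ℓ / r)))) := by
          gcongr
          refine (abs_sub _ _).trans ?_
          rw [abs_mul, abs_of_nonneg ha0]
          nlinarith [mul_le_mul_of_nonneg_left e₂ ha0, mul_le_mul_of_nonneg_right ha hT]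
      _ = (1 + c₀ ^ 2) * (c₀ * (Real.log B + 2 + Real.log (ℓ / r))) := by field_simp
      _ ≤ (1 + c₀ ^ 2) * (c₀ * (Real.log B + 2)) * (1 + Real.log (ℓ / r)) := by
          rw [mul_assoc, mul_assoc]
          gcongr
          nlinarith [mul_nonneg hlogB hL]
end
end

section
/- Let μ be a 1-AD-regular measure on ℝ² with AD-regularity constant c₀. Let y₁, y₂ ∈ supp μ and ℓ > 0 satisfy 3ℓ ≤ |y₁ − y₂| ≤ 4c₀²ℓ, let r > 0, and set B₁ = B(y₁,r), B₂ = B(y₂,r), and define g(x) = ∫_{B₁} (1/r) log(1/|x−y|) dμ(y) − (μ(B₁)/μ(B₂)) ∫_{B₂} (1/r) log(1/|x−y|) dμ(y). Let e ∈ ℝ² be a unit vector, p = y₁ + 10 r e, and V = B(p, r). Then there are constants c > 0 and C₂ ≥ 1, depending only on c₀, such that if r ≤ ℓ/C₂ then the directional derivative satisfies −∂_e g(x) ≥ c/r for every x ∈ V. -/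
open Metric MeasureTheory Set Filter
open scoped ENNReal NNReal Topology

noncomputable section

section LogarithmicPotential

variable {E : Type*} [NormedAddCommGroup E] [InnerProductSpace ℝ E]

theorem hasFDerivAt_log_one_div_dist {x y : E} (h : x ≠ y) :
    HasFDerivAt (fun z => Real.log (1 / dist z y))
      (-((‖x - y‖ ^ 2)⁻¹ • innerSL ℝ (x - y))) x := by
  have hne : ‖x - y‖ ^ 2 ≠ 0 := pow_ne_zero 2 (norm_ne_zero_iff.2 (sub_ne_zero.2 h))
  have h1 : HasFDerivAt (fun z : E => ‖z - y‖ ^ 2) (2 • innerSL ℝ (x - y)) x := by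
    simpa using ((hasFDerivAt_id x).sub_const y).norm_sq
  have h2 := (h1.log hne).const_mul (-(1 / 2 : ℝ))
  refine (h2.congr_fderiv ?_).congr_of_eventuallyEq (Eventually.of_forall fun z => ?_)
  · ext v
    simp
    ring
  · simp only [one_div, Real.log_inv, dist_eq_norm, Real.log_pow]
    push_cast
    ring

theorem norm_inv_sq_smul_innerSL_le {δ : ℝ} (hδ : 0 < δ) {v : E} (hv : δ ≤ ‖v‖) :
    ‖(‖v‖ ^ 2)⁻¹ • innerSL ℝ v‖ ≤ δ⁻¹ := by
  have hv0 : 0 < ‖v‖ := hδ.trans_le hv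
  rw [norm_smul, innerSL_apply_norm, norm_inv, norm_pow, norm_norm]
  calc (‖v‖ ^ 2)⁻¹ * ‖v‖ = ‖v‖⁻¹ := by field_simp
    _ ≤ δ⁻¹ := inv_anti₀ hδ hv

theorem Real.abs_log_le_add_inv {t : ℝ} (ht : 0 < t) : |Real.log t| ≤ t + t⁻¹ := by
  have h1 := Real.log_le_sub_one_of_pos ht
  have h2 := Real.log_le_sub_one_of_pos (inv_pos.2 ht)
  rw [Real.log_inv] at h2
  have h3 := inv_pos.2 ht
  exact abs_le.2 ⟨by linarith, by linarith⟩

variable [MeasurableSpace E] [BorelSpace E] [SecondCountableTopology E]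
  {μ : Measure E} {s : Set E} {x : E} {δ : ℝ}

theorem aestronglyMeasurable_inv_sq_smul_innerSL (hs : MeasurableSet s) (hδ : 0 < δ)
    (hx : ∀ y ∈ s, δ ≤ dist x y) :
    AEStronglyMeasurable (fun y => (‖x - y‖ ^ 2)⁻¹ • innerSL ℝ (x - y)) (μ.restrict s) := by
  refine ContinuousOn.aestronglyMeasurable ?_ hs
  refine ContinuousOn.smul (ContinuousOn.inv₀ (f := fun y => ‖x - y‖ ^ 2) (by fun_prop)
    fun y hy => ?_) ?_
  · rw [← dist_eq_norm]
    exact pow_ne_zero 2 (hδ.trans_le (hx y hy)).ne'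
  · exact ((innerSL ℝ (E := E)).continuous.comp (continuous_const.sub continuous_id)).continuousOn

theorem integrableOn_inv_sq_smul_innerSL (hs : MeasurableSet s) (hμ : μ s ≠ ∞) (hδ : 0 < δ)
    (hx : ∀ y ∈ s, δ ≤ dist x y) :
    IntegrableOn (fun y => (‖x - y‖ ^ 2)⁻¹ • innerSL ℝ (x - y)) s μ :=
  IntegrableOn.of_bound hμ.lt_top (aestronglyMeasurable_inv_sq_smul_innerSL hs hδ hx) δ⁻¹ <|
    (ae_restrict_iff' hs).2 <| Eventually.of_forall fun y hy =>
      norm_inv_sq_smul_innerSL_le hδ (dist_eq_norm x y ▸ hx y hy)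

/-- The logarithmic potential of a finite measure on a bounded set may be differentiated under
the integral sign at positive distance from that set. -/
theorem hasFDerivAt_setIntegral_log_one_div_dist (hs : MeasurableSet s) (hμ : μ s ≠ ∞)
    (hb : Bornology.IsBounded s) (hδ : 0 < δ) (hx : ∀ y ∈ s, δ ≤ dist x y) :
    HasFDerivAt (fun z => ∫ y in s, Real.log (1 / dist z y) ∂μ)
      (∫ y in s, -((‖x - y‖ ^ 2)⁻¹ • innerSL ℝ (x - y)) ∂μ) x := by
  obtain ⟨M, hM⟩ := hb.subset_closedBall x
  have hnear : ∀ z ∈ ball x (δ / 2), ∀ y ∈ s, δ / 2 ≤ dist z y := fun z hz y hy => by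
    have h1 := hx y hy
    have h2 := dist_triangle x z y
    rw [mem_ball, dist_comm] at hz
    linarith
  have hmeas : ∀ z, AEStronglyMeasurable (fun y => Real.log (1 / dist z y)) (μ.restrict s) :=
    fun z => (Real.measurable_log.comp
      (measurable_const.div (measurable_const.dist measurable_id))).aestronglyMeasurable
  refine hasFDerivAt_integral_of_dominated_of_fderiv_le (bound := fun _ => (δ / 2)⁻¹)
    (F' := fun x y => -((‖x - y‖ ^ 2)⁻¹ • innerSL ℝ (x - y)))
    (ball_mem_nhds x (half_pos hδ)) (Eventually.of_forall hmeas) ?_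
    (aestronglyMeasurable_inv_sq_smul_innerSL hs hδ hx).neg ?_ (integrableOn_const hμ) ?_
  · refine IntegrableOn.of_bound hμ.lt_top (hmeas x) (M + δ⁻¹) ?_
    refine (ae_restrict_iff' hs).2 <| Eventually.of_forall fun y hy => ?_
    have hpos : 0 < dist x y := hδ.trans_le (hx y hy)
    rw [one_div, Real.log_inv, norm_neg, Real.norm_eq_abs]
    have h1 : dist x y ≤ M := by simpa [dist_comm] using hM hy
    exact (Real.abs_log_le_add_inv hpos).trans (add_le_add h1 (inv_anti₀ hδ (hx y hy)))
  · refine (ae_restrict_iff' hs).2 <| Eventually.of_forall fun y hy z hz => ?_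
    rw [norm_neg]
    exact norm_inv_sq_smul_innerSL_le (half_pos hδ) (dist_eq_norm z y ▸ hnear z hz y hy)
  · refine (ae_restrict_iff' hs).2 <| Eventually.of_forall fun y hy z hz => ?_
    exact hasFDerivAt_log_one_div_dist (dist_pos.1 ((half_pos hδ).trans_le (hnear z hz y hy)))

end LogarithmicPotential

/-- The derivative of `logPot` away from the two balls. -/
theorem neg_fderiv_logPot_apply {μ : Measure (EuclideanSpace ℝ (Fin 2))}
    {y₁ y₂ x e : EuclideanSpace ℝ (Fin 2)} {r δ : ℝ}
    (hμ₁ : μ (ball y₁ r) ≠ ∞) (hμ₂ : μ (ball y₂ r) ≠ ∞) (hδ : 0 < δ)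
    (hx₁ : ∀ y ∈ ball y₁ r, δ ≤ dist x y) (hx₂ : ∀ y ∈ ball y₂ r, δ ≤ dist x y) :
    -fderiv ℝ (logPot μ y₁ y₂ r) x e =
      (1 / r) * ((∫ y in ball y₁ r, (‖x - y‖ ^ 2)⁻¹ * inner ℝ (x - y) e ∂μ) -
        (μ.real (ball y₁ r) / μ.real (ball y₂ r)) *
          ∫ y in ball y₂ r, (‖x - y‖ ^ 2)⁻¹ * inner ℝ (x - y) e ∂μ) := by
  have key : ∀ c, μ (ball c r) ≠ ∞ → (∀ y ∈ ball c r, δ ≤ dist x y) →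
      HasFDerivAt (fun z => ∫ y in ball c r, (1 / r) * Real.log (1 / dist z y) ∂μ)
        ((1 / r) • ∫ y in ball c r, -((‖x - y‖ ^ 2)⁻¹ • innerSL ℝ (x - y)) ∂μ) x := by
    intro c hμ hx
    simp_rw [integral_const_mul]
    exact (hasFDerivAt_setIntegral_log_one_div_dist measurableSet_ball hμ
      isBounded_ball hδ hx).const_mul (1 / r)
  have happ : ∀ c, μ (ball c r) ≠ ∞ → (∀ y ∈ ball c r, δ ≤ dist x y) →
      (∫ y in ball c r, -((‖x - y‖ ^ 2)⁻¹ • innerSL ℝ (x - y)) ∂μ) e =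
        -∫ y in ball c r, (‖x - y‖ ^ 2)⁻¹ * inner ℝ (x - y) e ∂μ := by
    intro c hμ hx
    rw [integral_neg, neg_apply, ContinuousLinearMap.integral_apply
      (integrableOn_inv_sq_smul_innerSL measurableSet_ball hμ hδ hx)]
    simp only [smul_apply, innerSL_apply_apply, smul_eq_mul]
  have hd := (key y₁ hμ₁ hx₁).sub ((key y₂ hμ₂ hx₂).const_mul
    ((μ (ball y₁ r)).toReal / (μ (ball y₂ r)).toReal))
  have hfd : fderiv ℝ (logPot μ y₁ y₂ r) x = _ := hd.fderiv
  rw [hfd, sub_apply, smul_apply, smul_apply, smul_apply, happ y₁ hμ₁ hx₁, happ y₂ hμ₂ hx₂]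
  simp only [smul_eq_mul, Measure.real]
  ring

/-- gradient lower bound for the auxiliary logarithmic potential on the
ball `V = B(y₁ + 10 r e, r)` in the plane, provided `r ≤ ℓ/C₂`. -/
theorem log_potential_gradient_lower
    (c₀ : ℝ) (hc₀ : 0 < c₀) :
    ∃ c C₂ : ℝ, 0 < c ∧ 1 ≤ C₂ ∧
      ∀ μ : Measure (EuclideanSpace ℝ (Fin 2)), ADRegularMeasureWith c₀ 1 μ →
        ∀ y₁ ∈ measSupport μ, ∀ y₂ ∈ measSupport μ, ∀ ℓ r : ℝ, 0 < ℓ →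
          3 * ℓ ≤ dist y₁ y₂ → dist y₁ y₂ ≤ 4 * c₀ ^ 2 * ℓ → 0 < r → r ≤ ℓ / C₂ →
          ∀ e : EuclideanSpace ℝ (Fin 2), ‖e‖ = 1 →
            ∀ x ∈ ball (y₁ + (10 * r) • e) r,
              c / r ≤ -fderiv ℝ (logPot μ y₁ y₂ r) x e := by
  refine ⟨1 / (36 * c₀), 36, by positivity, by norm_num, ?_⟩
  intro μ hμ y₁ hy₁ y₂ hy₂ ℓ r hℓ hlow _ hr hrℓ e he x hx
  have hrℓ' : 36 * r ≤ ℓ := by linarith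
  have hdiam : ENNReal.ofReal r ≤ EMetric.diam (measSupport μ) := by
    refine le_trans ?_ (Metric.edist_le_ediam_of_mem hy₁ hy₂)
    rw [edist_dist]
    exact ENNReal.ofReal_le_ofReal (by linarith)
  obtain ⟨hm₁, hf₁⟩ := hμ y₁ hy₁ r hr hdiam
  obtain ⟨-, hf₂⟩ := hμ y₂ hy₂ r hr hdiam
  have hμ₁ : μ (ball y₁ r) ≠ ∞ := (hf₁.trans_lt ENNReal.ofReal_lt_top).ne
  have hμ₂ : μ (ball y₂ r) ≠ ∞ := (hf₂.trans_lt ENNReal.ofReal_lt_top).ne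
  have hm : c₀⁻¹ * r ≤ μ.real (ball y₁ r) := by
    rw [pow_one] at hm₁
    exact (ENNReal.ofReal_le_iff_le_toReal hμ₁).1 hm₁
  have hm₂ : 0 < μ.real (ball y₂ r) := ENNReal.toReal_pos (hy₂ r hr).ne' hμ₂
  rw [mem_ball, dist_eq_norm] at hx
  have hnear : ∀ y ∈ ball y₁ r, 8 * r ≤ inner ℝ (x - y) e ∧ ‖x - y‖ ≤ 12 * r := by
    intro y hy
    rw [mem_ball, dist_eq_norm] at hy
    set w := (x - (y₁ + (10 * r) • e)) - (y - y₁) with hw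
    have hwn : ‖w‖ ≤ 2 * r := (norm_sub_le _ _).trans (by linarith)
    have hxy : x - y = (10 * r) • e + w := by rw [hw]; abel
    have hne : ‖(10 * r) • e‖ = 10 * r := by
      rw [norm_smul, he, mul_one, Real.norm_of_nonneg (by positivity)]
    constructor
    · have h1 := abs_le.1 (abs_real_inner_le_norm w e)
      rw [he, mul_one] at h1
      rw [hxy, inner_add_left, real_inner_smul_left, real_inner_self_eq_norm_sq, he]
      linarith [h1.1]
    · rw [hxy]
      exact (norm_add_le _ _).trans (by linarith)
  have hdist₁ : ∀ y ∈ ball y₁ r, 8 * r ≤ dist x y := fun y hy => by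
    have h1 := real_inner_le_norm (x - y) e
    rw [he, mul_one, ← dist_eq_norm] at h1
    exact (hnear y hy).1.trans h1
  have hdist₂ : ∀ y ∈ ball y₂ r, ℓ ≤ dist x y := fun y hy => by
    have h1 := (hnear y₁ (mem_ball_self hr)).2
    rw [← dist_eq_norm] at h1
    have h2 := dist_triangle4 y₁ x y y₂
    rw [dist_comm y₁ x] at h2
    rw [mem_ball] at hy
    linarith
  rw [neg_fderiv_logPot_apply (δ := 8 * r) hμ₁ hμ₂ (by positivity) hdist₁
    fun y hy => le_trans (by linarith) (hdist₂ y hy)]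
  have hI₁ : (18 * r)⁻¹ * μ.real (ball y₁ r) ≤
      ∫ y in ball y₁ r, (‖x - y‖ ^ 2)⁻¹ * inner ℝ (x - y) e ∂μ := by
    refine setIntegral_ge_of_const_le_real measurableSet_ball hμ₁ (fun y hy => ?_) ?_
    · obtain ⟨h1, h2⟩ := hnear y hy
      have h3 := hdist₁ y hy
      rw [dist_eq_norm] at h3
      have h4 : 0 < ‖x - y‖ := lt_of_lt_of_le (by positivity) h3
      calc (18 * r)⁻¹ = ((12 * r) ^ 2)⁻¹ * (8 * r) := by field_simp; norm_num
        _ ≤ (‖x - y‖ ^ 2)⁻¹ * inner ℝ (x - y) e := by gcongr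
    · simpa [IntegrableOn, inner_sub_left] using (ContinuousLinearMap.apply ℝ ℝ e).integrable_comp
        (integrableOn_inv_sq_smul_innerSL measurableSet_ball hμ₁ (by positivity) hdist₁)
  have hI₂ : (∫ y in ball y₂ r, (‖x - y‖ ^ 2)⁻¹ * inner ℝ (x - y) e ∂μ) ≤
      (36 * r)⁻¹ * μ.real (ball y₂ r) := by
    refine (Real.le_norm_self _).trans
      (norm_setIntegral_le_of_norm_le_const hμ₂.lt_top fun y hy => ?_)
    have h1 := ContinuousLinearMap.le_opNorm ((‖x - y‖ ^ 2)⁻¹ • innerSL ℝ (x - y)) e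
    rw [he, mul_one] at h1
    refine (le_of_eq_of_le (by simp [inner_sub_left]) h1).trans
      (norm_inv_sq_smul_innerSL_le (by positivity) ?_)
    exact hrℓ'.trans (dist_eq_norm x y ▸ hdist₂ y hy)
  have hI₃ : (μ.real (ball y₁ r) / μ.real (ball y₂ r)) *
      (∫ y in ball y₂ r, (‖x - y‖ ^ 2)⁻¹ * inner ℝ (x - y) e ∂μ) ≤
        (36 * r)⁻¹ * μ.real (ball y₁ r) :=
    (mul_le_mul_of_nonneg_left hI₂ (by positivity)).trans_eq (by field_simp)
  calc 1 / (36 * c₀) / r = (1 / r) * ((36 * r)⁻¹ * (c₀⁻¹ * r)) := by field_simp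
    _ ≤ (1 / r) * ((36 * r)⁻¹ * μ.real (ball y₁ r)) := by gcongr
    _ = (1 / r) * ((18 * r)⁻¹ * μ.real (ball y₁ r) - (36 * r)⁻¹ * μ.real (ball y₁ r)) := by
      field_simp; norm_num
    _ ≤ _ := by gcongr
end
end
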